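/- arXiv:1210.4230 — 3 statements merged into one kernel-verified Lean document; each statement's English description precedes it below -/
import Mathlib

section
/- Let S be an (s,t)-switchable set with s ≥ 2, consisting of a single connectedness class, and let p = Π_{i=1}^d x_{a_i} − Π_{i=1}^d x_{b_i} with a_i, b_i ∈ S, in the case s ≥ t. Then p lies in the ideal Ĩ(s,t)_S generated by the generalized minors f_{i,a,b} (i ∈ [t], a, b connected in S) if and only if Σ_{i=1}^d ‖a_i‖_s = Σ_{i=1}^d ‖b_i‖_s and the multiset {(a_{1,s+1},…,a_{1,n}), …, (a_{d,s+1},…,a_{d,n})} equals the multiset {(b_{1,s+1},…,b_{1,n}), …, (b_{d,s+1},…,b_{d,n})}. -/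
open Finset

/-- The set of indices: `a i` (a value in `Fin (r i)`) represents the entry `a_i = (a i) + 1`
of an index in `[r 1] × ⋯ × [r n]`.  So `0` corresponds to the entry `1` and `r i - 1`
to the entry `r i`. -/
abbrev Idx (n : ℕ) (r : Fin n → ℕ) := ∀ i : Fin n, Fin (r i)

/-- `a` and `b` are `s`-equivalent: equal sums of the first `s` components and equal
remaining components. -/
def sEquiv (n s : ℕ) (r : Fin n → ℕ) (a b : Idx n r) : Prop :=
  (∑ i ∈ Finset.univ.filter (fun i : Fin n => (i : ℕ) < s), (a i : ℕ)) =
    (∑ i ∈ Finset.univ.filter (fun i : Fin n => (i : ℕ) < s), (b i : ℕ)) ∧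
  ∀ i : Fin n, s ≤ (i : ℕ) → a i = b i

/-- The switch of `a` and `b` with respect to a single component `i`. -/
def sw {n : ℕ} {r : Fin n → ℕ} (i : Fin n) (a b : Idx n r) : Idx n r :=
  fun j => if j = i then b j else a j

/-- The switch of `a` and `b` with respect to a set `L` of components. -/
def swL {n : ℕ} {r : Fin n → ℕ} (L : Finset (Fin n)) (a b : Idx n r) : Idx n r :=
  fun j => if j ∈ L then b j else a j

/-- An `(s,t)`-switchable subset of the set of indices. -/
def Switchable (n s t : ℕ) (r : Fin n → ℕ) (S : Set (Idx n r)) : Prop :=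
  (∀ a b, a ∈ S → b ∈ S → hammingDist a b = 2 →
    ∀ i : Fin n, (i : ℕ) < t → sw i a b ∈ S) ∧
  (∀ a b, a ∈ S → sEquiv n s r a b → b ∈ S)

/-- `c 0, c 1, …, c k` is a path in `S`: all members lie in `S` and consecutive members
have Hamming distance `1`. -/
def IsPathIn {n : ℕ} {r : Fin n → ℕ} (S : Set (Idx n r)) (c : ℕ → Idx n r) (k : ℕ) : Prop :=
  (∀ j ≤ k, c j ∈ S) ∧ ∀ j < k, hammingDist (c j) (c (j + 1)) = 1

/-- `a` and `b` are connected in `S`. -/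
def ConnectedIn {n : ℕ} {r : Fin n → ℕ} (S : Set (Idx n r)) (a b : Idx n r) : Prop :=
  ∃ k c, c 0 = a ∧ c k = b ∧ IsPathIn S c k

/-- The setoid of `s`-equivalence on the set of indices. -/
def sSetoid (n s : ℕ) (r : Fin n → ℕ) : Setoid (Idx n r) where
  r := sEquiv n s r
  iseqv := ⟨fun _ => ⟨rfl, fun _ _ => rfl⟩,
    fun h => ⟨h.1.symm, fun i hi => (h.2 i hi).symm⟩,
    fun h g => ⟨h.1.trans g.1, fun i hi => (h.2 i hi).trans (g.2 i hi)⟩⟩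

/-- The variables of the ring `R` are indexed by `s`-equivalence classes of indices,
i.e. `x a = x b` iff `a` and `b` are `s`-equivalent. -/
abbrev IQ (n s : ℕ) (r : Fin n → ℕ) := Quotient (sSetoid n s r)

/-- The variable `x_a` of the polynomial ring `R = k[x_a : a ∈ N]`. -/
noncomputable def xvar (k : Type) [CommRing k] {n : ℕ} (s : ℕ) {r : Fin n → ℕ}
    (a : Idx n r) : MvPolynomial (IQ n s r) k :=
  MvPolynomial.X (Quotient.mk (sSetoid n s r) a)

/-- The generalized `2 × 2` minor `f_{i,a,b} = x_a x_b − x_{sw(i,a,b)} x_{sw(i,b,a)}`. -/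
noncomputable def gminor (k : Type) [CommRing k] {n : ℕ} (s : ℕ) {r : Fin n → ℕ}
    (i : Fin n) (a b : Idx n r) : MvPolynomial (IQ n s r) k :=
  xvar k s a * xvar k s b - xvar k s (sw i a b) * xvar k s (sw i b a)

/-- The ideal `I(s,t)`, generated by the slice minors `f_{i,a,b}` with `d(a,b) = 2`
and `i ∈ [t]`. -/
noncomputable def ISlice (k : Type) [CommRing k] {n : ℕ} (s t : ℕ) (r : Fin n → ℕ) :
    Ideal (MvPolynomial (IQ n s r) k) :=
  Ideal.span {f | ∃ i : Fin n, ∃ a b : Idx n r,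
    (i : ℕ) < t ∧ hammingDist a b = 2 ∧ f = gminor k s i a b}

/-- The ideal `Ĩ(s,t)`, generated by all generalized minors `f_{i,a,b}` with `i ∈ [t]`. -/
noncomputable def ITilde (k : Type) [CommRing k] {n : ℕ} (s t : ℕ) (r : Fin n → ℕ) :
    Ideal (MvPolynomial (IQ n s r) k) :=
  Ideal.span {f | ∃ i : Fin n, ∃ a b : Idx n r, (i : ℕ) < t ∧ f = gminor k s i a b}

/-- The ideal `Ĩ(s,t)_S`, generated by the generalized minors `f_{i,a,b}` with `i ∈ [t]`
and `a, b` connected in `S`. -/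
noncomputable def ITildeS (k : Type) [CommRing k] {n : ℕ} (s t : ℕ) {r : Fin n → ℕ}
    (S : Set (Idx n r)) : Ideal (MvPolynomial (IQ n s r) k) :=
  Ideal.span {f | ∃ i : Fin n, ∃ a b : Idx n r,
    (i : ℕ) < t ∧ ConnectedIn S a b ∧ f = gminor k s i a b}


section Helpers

variable {n : ℕ} {r : Fin n → ℕ}

/-- sum of the first `s` components -/
def nrm (s : ℕ) (a : Idx n r) : ℕ :=
  ∑ i ∈ Finset.univ.filter (fun i : Fin n => (i : ℕ) < s), (a i : ℕ)

/-- same tail -/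
def tl (s : ℕ) (a b : Idx n r) : Prop := ∀ i : Fin n, s ≤ (i : ℕ) → a i = b i

/-- maximal norm -/
def tot (s : ℕ) (r : Fin n → ℕ) : ℕ :=
  ∑ i ∈ Finset.univ.filter (fun i : Fin n => (i : ℕ) < s), (r i - 1)

lemma nrm_le_tot (s : ℕ) (a : Idx n r) : nrm s a ≤ tot s r := by
  apply Finset.sum_le_sum
  intro i _
  have := (a i).2
  omega

lemma exists_btw {ι : Type*} [DecidableEq ι] (F : Finset ι) (lo hi : ι → ℕ)
    (h : ∀ i, lo i ≤ hi i) : ∀ A, ∑ i ∈ F, lo i ≤ A → A ≤ ∑ i ∈ F, hi i →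
    ∃ g : ι → ℕ, (∀ i, lo i ≤ g i ∧ g i ≤ hi i) ∧ ∑ i ∈ F, g i = A := by
  induction F using Finset.induction_on with
  | empty =>
    intro A h1 h2
    refine ⟨lo, fun i => ⟨le_rfl, h i⟩, ?_⟩
    simp at *; omega
  | insert i F hi' ih =>
    intro A h1 h2
    rw [Finset.sum_insert hi'] at h1 h2
    have hii := h i
    have hs : ∑ i ∈ F, lo i ≤ ∑ i ∈ F, hi i := Finset.sum_le_sum fun i _ => h i
    obtain ⟨g, hg, hg2⟩ := ih (A - min (hi i) (A - ∑ i ∈ F, lo i)) (by omega) (by omega)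
    refine ⟨Function.update g i (min (hi i) (A - ∑ i ∈ F, lo i)), ?_, ?_⟩
    · intro j
      by_cases hj : j = i
      · subst hj; simp only [Function.update_self]; omega
      · simp only [Function.update_of_ne hj]; exact hg j
    · rw [Finset.sum_insert hi', Function.update_self, Finset.sum_update_of_notMem hi', hg2]
      omega

lemma exists_vec (s : ℕ) (a : Idx n r) (lo hi : Fin n → ℕ) (h : ∀ i, lo i ≤ hi i)
    (hr : ∀ i, hi i < r i) (A : ℕ)
    (h1 : ∑ i ∈ Finset.univ.filter (fun i : Fin n => (i : ℕ) < s), lo i ≤ A)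
    (h2 : A ≤ ∑ i ∈ Finset.univ.filter (fun i : Fin n => (i : ℕ) < s), hi i) :
    ∃ a' : Idx n r, tl s a' a ∧ nrm s a' = A ∧
      ∀ i : Fin n, (i : ℕ) < s → lo i ≤ a' i ∧ (a' i : ℕ) ≤ hi i := by
  obtain ⟨g, hg, hg2⟩ := exists_btw _ lo hi h A h1 h2
  refine ⟨fun i => if (i : ℕ) < s then ⟨g i, (hg i).2.trans_lt (hr i)⟩ else a i, ?_, ?_, ?_⟩
  · intro i hi
    simp [not_lt.2 hi]
  · rw [← hg2]
    apply Finset.sum_congr rfl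
    intro i hi
    simp only [Finset.mem_filter, Finset.mem_univ, true_and] at hi
    simp [hi]
  · intro i hi
    simpa [hi] using hg i

lemma tot_eq (s : ℕ) (r : Fin n → ℕ) (i : Fin n) (hi : (i : ℕ) < s) :
    tot s r = (r i - 1) +
      ∑ j ∈ (Finset.univ.filter (fun i : Fin n => (i : ℕ) < s)).erase i, (r j - 1) :=
  (Finset.add_sum_erase _ (fun j => r j - 1) (by simpa using hi)).symm

lemma nrm_eq (s : ℕ) (a : Idx n r) (i : Fin n) (hi : (i : ℕ) < s) :
    nrm s a = (a i : ℕ) +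
      ∑ j ∈ (Finset.univ.filter (fun i : Fin n => (i : ℕ) < s)).erase i, (a j : ℕ) :=
  (Finset.add_sum_erase _ (fun j => (a j : ℕ)) (by simpa using hi)).symm

lemma tot_lt (s : ℕ) (hr : ∀ i, 2 ≤ r i) (i j : Fin n) (hi : (i : ℕ) < s) (hj : (j : ℕ) < s)
    (hij : j ≠ i) : r i ≤ tot s r := by
  rw [tot_eq s r i hi]
  have : r j - 1 ≤ ∑ j ∈ (Finset.univ.filter (fun i : Fin n => (i : ℕ) < s)).erase i, (r j - 1) :=
    Finset.single_le_sum (f := fun j => r j - 1) (fun _ _ => Nat.zero_le _) (by simp [hij, hj])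
  have := hr i
  have := hr j
  omega

/-- prescribed component -/
lemma exists_comp (s : ℕ) (hr : ∀ i, 2 ≤ r i) (i : Fin n) (hi : (i : ℕ) < s) (a : Idx n r)
    (A α : ℕ) (h1 : α ≤ A) (h2 : α + 1 ≤ r i) (h3 : A + (r i - 1) ≤ α + tot s r) :
    ∃ a' : Idx n r, tl s a' a ∧ nrm s a' = A ∧ (a' i : ℕ) = α := by
  have hmem : i ∈ Finset.univ.filter (fun i : Fin n => (i : ℕ) < s) := by simpa using hi
  obtain ⟨a', x1, x2, x3⟩ := exists_vec s a (fun j => if j = i then α else 0)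
    (fun j => if j = i then α else r j - 1)
    (fun j => by split_ifs <;> omega)
    (fun j => by
      have := hr j
      try dsimp only
      split_ifs with h
      · subst h; omega
      · omega) A
    (by
      rw [← Finset.add_sum_erase _ _ hmem, Finset.sum_eq_zero]
      · simpa using h1
      · intro j hj
        simp [Finset.ne_of_mem_erase hj])
    (by
      rw [← Finset.add_sum_erase _ _ hmem]
      rw [tot_eq s r i hi] at h3
      rw [Finset.sum_congr rfl (g := fun j => r j - 1)]
      · simp only [if_true]; omega
      · intro j hj
        simp [Finset.ne_of_mem_erase hj])
  refine ⟨a', x1, x2, ?_⟩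
  have := x3 i hi
  simp at this
  omega

lemma exists_nrm (s : ℕ) (a : Idx n r) (hr : ∀ i, 2 ≤ r i) (A : ℕ) (h : A ≤ tot s r) :
    ∃ a' : Idx n r, tl s a' a ∧ nrm s a' = A := by
  obtain ⟨a', x1, x2, _⟩ := exists_vec s a (fun j => 0) (fun j => r j - 1) (fun _ => Nat.zero_le _)
    (fun j => by have := hr j; omega) A (by simp) h
  exact ⟨a', x1, x2⟩

lemma exists_two (s : ℕ) (hr : ∀ i, 2 ≤ r i) (i j : Fin n) (hi : (i : ℕ) < s) (hj : (j : ℕ) < s)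
    (hij : j ≠ i) (a : Idx n r) (A : ℕ) (h1 : 0 < A) (h2 : A < tot s r) :
    ∃ a' : Idx n r, tl s a' a ∧ nrm s a' = A ∧ (a' i : ℕ) + 1 < r i ∧ 0 < (a' j : ℕ) := by
  have hmemi : i ∈ Finset.univ.filter (fun i : Fin n => (i : ℕ) < s) := by simpa using hi
  have hmemj : j ∈ Finset.univ.filter (fun i : Fin n => (i : ℕ) < s) := by simpa using hj
  have hri := hr i
  obtain ⟨a', x1, x2, x3⟩ := exists_vec s a (fun l => if l = j then 1 else 0)
    (fun l => if l = i then r i - 2 else r l - 1)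
    (fun l => by
      have := hr l
      try dsimp only
      split_ifs with h h' h'
      · exact absurd (h.symm.trans h') hij
      all_goals omega)
    (fun l => by
      have := hr l
      try dsimp only
      split_ifs with h
      · subst h; omega
      · omega) A
    (by
      rw [← Finset.add_sum_erase _ _ hmemj, Finset.sum_eq_zero]
      · simpa using Nat.succ_le_of_lt h1
      · intro l hl
        simp [Finset.ne_of_mem_erase hl])
    (by
      rw [← Finset.add_sum_erase _ _ hmemi]
      rw [tot_eq s r i hi] at h2
      rw [Finset.sum_congr rfl (g := fun j => r j - 1)]
      · simp only [if_true]; omega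
      · intro j hj
        simp [Finset.ne_of_mem_erase hj])
  refine ⟨a', x1, x2, ?_, ?_⟩
  · have := (x3 i hi).2
    simp at this
    omega
  · have := (x3 j hj).1
    simp at this
    omega

lemma nrm_update (s : ℕ) (a : Idx n r) (i : Fin n) (hi : (i : ℕ) < s) (v : Fin (r i)) :
    nrm s (Function.update a i v) + a i = nrm s a + v := by
  rw [nrm_eq s _ i hi, nrm_eq s a i hi, Function.update_self]
  rw [Finset.sum_congr rfl (g := fun j => (a j : ℕ))]
  · omega
  · intro j hj
    rw [Function.update_of_ne (Finset.ne_of_mem_erase hj)]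

lemma sw_eq_update (i : Fin n) (a b : Idx n r) : sw i a b = Function.update a i (b i) := by
  funext j
  unfold sw
  by_cases h : j = i
  · subst h; simp
  · simp [h]

lemma tl_update (s : ℕ) (a : Idx n r) (i : Fin n) (hi : (i : ℕ) < s) (v : Fin (r i)) :
    tl s (Function.update a i v) a := by
  intro j hj
  rw [Function.update_of_ne]
  rintro rfl
  omega

lemma tl.trans {s : ℕ} {a b c : Idx n r} (h : tl s a b) (g : tl s b c) : tl s a c :=
  fun i hi => (h i hi).trans (g i hi)

lemma tl.symm {s : ℕ} {a b : Idx n r} (h : tl s a b) : tl s b a :=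
  fun i hi => (h i hi).symm

lemma hd_one {a b : Idx n r} (h : hammingDist a b = 1) :
    ∃ i, a i ≠ b i ∧ ∀ j, j ≠ i → a j = b j := by
  unfold hammingDist at h
  obtain ⟨i, hi⟩ := Finset.card_eq_one.1 h
  simp only [Finset.ext_iff, Finset.mem_filter, Finset.mem_univ, true_and,
    Finset.mem_singleton] at hi
  exact ⟨i, (hi i).2 rfl, fun j hj => by_contra fun hc => hj ((hi j).1 hc)⟩

lemma hd_two {a b : Idx n r} (i j : Fin n) (hij : i ≠ j) (hi : a i ≠ b i) (hj : a j ≠ b j)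
    (h : ∀ l, l ≠ i → l ≠ j → a l = b l) : hammingDist a b = 2 := by
  unfold hammingDist
  rw [Finset.card_eq_two]
  refine ⟨i, j, hij, ?_⟩
  ext l
  simp only [Finset.mem_filter, Finset.mem_univ, true_and, Finset.mem_insert,
    Finset.mem_singleton]
  constructor
  · intro hl
    by_contra! hc
    exact hl (h l hc.1 hc.2)
  · rintro (rfl | rfl) <;> assumption

lemma path_ind (S : Set (Idx n r)) (Q : Idx n r → Prop)
    (h : ∀ a b, a ∈ S → b ∈ S → hammingDist a b = 1 → Q a → Q b) (a b : Idx n r)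
    (hab : ConnectedIn S a b) (ha : Q a) : Q b := by
  obtain ⟨k, c, rfl, rfl, hc1, hc2⟩ := hab
  have : ∀ j ≤ k, Q (c j) := by
    intro j
    induction j with
    | zero => exact fun _ => ha
    | succ j ih =>
      intro hj
      exact h _ _ (hc1 j (by omega)) (hc1 _ hj) (hc2 j (by omega)) (ih (by omega))
  exact this k le_rfl

lemma mem_of_nrm {s t : ℕ} {S : Set (Idx n r)} (hSw : Switchable n s t r S) {a b : Idx n r}
    (ha : a ∈ S) (h : nrm s a = nrm s b) (ht : tl s a b) : b ∈ S :=
  hSw.2 a b ha ⟨h, ht⟩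

/-- full tail fibre -/
def Full (s : ℕ) (S : Set (Idx n r)) (a : Idx n r) : Prop := ∀ c, tl s c a → c ∈ S

lemma step_up_down {s t : ℕ} {S : Set (Idx n r)} (hSw : Switchable n s t r S)
    (hr : ∀ i, 2 ≤ r i) (i j : Fin n) (hit : (i : ℕ) < t) (hi : (i : ℕ) < s) (hj : (j : ℕ) < s)
    (hij : j ≠ i) (a : Idx n r) (ha : a ∈ S) (h1 : 0 < nrm s a) (h2 : nrm s a < tot s r) :
    (∃ b ∈ S, tl s b a ∧ nrm s b = nrm s a + 1) ∧
    (∃ b ∈ S, tl s b a ∧ nrm s b + 1 = nrm s a) := by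
  obtain ⟨x, x1, x2, x3, x4⟩ := exists_two s hr i j hi hj hij a _ h1 h2
  have hx : x ∈ S := mem_of_nrm hSw ha x2.symm x1.symm
  have hxj := (x j).2
  let u := Function.update x i ⟨x i + 1, x3⟩
  have hu : tl s u x := tl_update s x i hi _
  have hun : nrm s u = nrm s x + 1 := by
    have := nrm_update s x i hi ⟨x i + 1, x3⟩
    try simp only at this
    change nrm s u + _ = _ at this
    omega
  let v : Fin (r j) := ⟨x j - 1, by omega⟩
  let w := Function.update x j v
  have hw : tl s w x := tl_update s x j hj _
  have hwn : nrm s w + 1 = nrm s x := by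
    have := nrm_update s x j hj v
    simp only [v] at this
    change nrm s w + _ = _ at this
    omega
  let y := Function.update u j v
  have hy : tl s y x := (tl_update s u j hj _).trans hu
  have huj : u j = x j := Function.update_of_ne hij _ _
  have hyn : nrm s y = nrm s x := by
    have := nrm_update s u j hj v
    simp only [v, huj] at this
    change nrm s y + _ = _ at this
    omega
  have hyS : y ∈ S := mem_of_nrm hSw hx hyn.symm hy.symm
  have hyi : y i = ⟨x i + 1, x3⟩ := by
    simp only [y, u]
    rw [Function.update_of_ne hij.symm, Function.update_self]
  have hyj : y j = v := by simp [y]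
  have hyi' : x i ≠ y i := by
    rw [hyi]; intro h
    have := congrArg Fin.val h
    simp at this
  have hyj' : x j ≠ y j := by
    rw [hyj]; intro h
    have := congrArg Fin.val h
    simp [v] at this
    omega
  have hyl : ∀ l, l ≠ i → l ≠ j → x l = y l := by
    intro l hl hl'
    simp only [y, u]
    rw [Function.update_of_ne hl', Function.update_of_ne hl]
  have hd : hammingDist x y = 2 := hd_two i j hij.symm hyi' hyj' hyl
  have hd' : hammingDist y x = 2 := by rw [hammingDist_comm]; exact hd
  have e1 : sw i x y = u := by rw [sw_eq_update, hyi]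
  have e2 : sw i y x = w := by
    rw [sw_eq_update]
    funext l
    by_cases hl : l = i
    · subst hl
      simp [w, Function.update_of_ne hij.symm]
    · rw [Function.update_of_ne hl]
      by_cases hl' : l = j
      · subst hl'; simp [y, w]
      · simp [y, w, u, hl, hl']
  refine ⟨⟨u, e1 ▸ hSw.1 x y hx hyS hd i hit, hu.trans x1, by omega⟩,
    ⟨w, e2 ▸ hSw.1 y x hyS hx hd' i hit, hw.trans x1, by omega⟩⟩

lemma full_of_interior {s t : ℕ} {S : Set (Idx n r)} (hSw : Switchable n s t r S)
    (hr : ∀ i, 2 ≤ r i) (i j : Fin n) (hit : (i : ℕ) < t) (hi : (i : ℕ) < s) (hj : (j : ℕ) < s)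
    (hij : j ≠ i) (a : Idx n r) (ha : a ∈ S) (h1 : 0 < nrm s a) (h2 : nrm s a < tot s r) :
    Full s S a := by
  have up : ∀ d, nrm s a + d ≤ tot s r → ∃ b ∈ S, tl s b a ∧ nrm s b = nrm s a + d := by
    intro d
    induction d with
    | zero => exact fun _ => ⟨a, ha, fun _ _ => rfl, rfl⟩
    | succ d ih =>
      intro hd
      obtain ⟨b, hb, hb1, hb2⟩ := ih (by omega)
      obtain ⟨⟨c, hc, hc1, hc2⟩, -⟩ := step_up_down hSw hr i j hit hi hj hij b hb (by omega)
        (by omega)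
      exact ⟨c, hc, hc1.trans hb1, by omega⟩
  have down : ∀ d, d ≤ nrm s a → ∃ b ∈ S, tl s b a ∧ nrm s b + d = nrm s a := by
    intro d
    induction d with
    | zero => exact fun _ => ⟨a, ha, fun _ _ => rfl, rfl⟩
    | succ d ih =>
      intro hd
      obtain ⟨b, hb, hb1, hb2⟩ := ih (by omega)
      obtain ⟨-, ⟨c, hc, hc1, hc2⟩⟩ := step_up_down hSw hr i j hit hi hj hij b hb (by omega)
        (by omega)
      exact ⟨c, hc, hc1.trans hb1, by omega⟩
  intro c hc
  have hct := nrm_le_tot s c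
  rcases le_total (nrm s a) (nrm s c) with h | h
  · obtain ⟨b, hb, hb1, hb2⟩ := up (nrm s c - nrm s a) (by omega)
    exact mem_of_nrm hSw hb (by omega) (hb1.trans hc.symm)
  · obtain ⟨b, hb, hb1, hb2⟩ := down (nrm s a - nrm s c) (by omega)
    exact mem_of_nrm hSw hb (by omega) (hb1.trans hc.symm)

lemma comp_of_nrm_zero {s : ℕ} {a : Idx n r} (h : nrm s a = 0) (i : Fin n) (hi : (i : ℕ) < s) :
    (a i : ℕ) = 0 := by
  rw [nrm_eq s a i hi] at h
  omega

lemma comp_of_nrm_tot {s : ℕ} {a : Idx n r} (h : tot s r ≤ nrm s a) (i : Fin n)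
    (hi : (i : ℕ) < s) : r i - 1 ≤ (a i : ℕ) := by
  rw [nrm_eq s a i hi, tot_eq s r i hi] at h
  have : ∑ j ∈ (Finset.univ.filter (fun i : Fin n => (i : ℕ) < s)).erase i, (a j : ℕ) ≤
      ∑ j ∈ (Finset.univ.filter (fun i : Fin n => (i : ℕ) < s)).erase i, (r j - 1) := by
    apply Finset.sum_le_sum
    intro j _
    have := (a j).2
    omega
  omega

lemma full_of_ne {s t : ℕ} {S : Set (Idx n r)} (hSw : Switchable n s t r S)
    (hr : ∀ i, 2 ≤ r i) (i j : Fin n) (hit : (i : ℕ) < t) (hi : (i : ℕ) < s) (hj : (j : ℕ) < s)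
    (hij : j ≠ i) (a b : Idx n r) (ha : a ∈ S) (hb : b ∈ S) (hab : tl s a b)
    (hne : nrm s a ≠ nrm s b) (l : Fin n) (hl : (l : ℕ) < s) (hl' : a l = b l) :
    Full s S a := by
  have h1 := nrm_le_tot s a
  have h2 := nrm_le_tot s b
  have h3 := hr l
  by_cases hia : 0 < nrm s a ∧ nrm s a < tot s r
  · exact full_of_interior hSw hr i j hit hi hj hij a ha hia.1 hia.2
  by_cases hib : 0 < nrm s b ∧ nrm s b < tot s r
  · have := full_of_interior hSw hr i j hit hi hj hij b hb hib.1 hib.2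
    exact fun c hc => this c (hc.trans hab)
  exfalso
  have hl2 := congrArg Fin.val hl'
  rcases Nat.eq_zero_or_pos (nrm s a) with h0 | h0
  · have := comp_of_nrm_zero h0 l hl
    have := comp_of_nrm_tot (a := b) (s := s) (by omega) l hl
    omega
  · have := comp_of_nrm_zero (a := b) (s := s) (by omega) l hl
    have := comp_of_nrm_tot (a := a) (s := s) (by omega) l hl
    omega

lemma dichotomy {s t : ℕ} {S : Set (Idx n r)} (hSw : Switchable n s t r S)
    (hr : ∀ i, 2 ≤ r i) (i j : Fin n) (hit : (i : ℕ) < t) (hi : (i : ℕ) < s) (hj : (j : ℕ) < s)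
    (hij : j ≠ i) (hconn : ∀ a b, a ∈ S → b ∈ S → ConnectedIn S a b) :
    (∀ a b, a ∈ S → b ∈ S → nrm s a = nrm s b) ∨ (∀ a ∈ S, Full s S a) := by
  by_cases hF : ∃ a ∈ S, Full s S a
  · right
    obtain ⟨a, ha, hFa⟩ := hF
    intro b hb
    refine path_ind S (Full s S) ?_ a b (hconn a b ha hb) hFa
    clear a ha hFa b hb
    intro a b ha hb hd hFa
    obtain ⟨l, hl1, hl2⟩ := hd_one hd
    by_cases hls : (l : ℕ) < s
    · intro c hc
      apply hFa
      intro m hm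
      rw [hc m hm, hl2]
      rintro rfl
      omega
    · have hil : i ≠ l := by rintro rfl; exact hls hi
      have hri := hr i
      obtain ⟨v, hv⟩ : ∃ v : Fin (r i), v ≠ a i := by
        have : Nontrivial (Fin (r i)) := Fin.nontrivial_iff_two_le.2 hri
        exact exists_ne _
      have hy : Function.update a i v ∈ S := hFa _ (tl_update s a i hi v)
      have hd2 : hammingDist b (Function.update a i v) = 2 := by
        apply hd_two i l hil
        · rw [Function.update_self, ← hl2 i hil]; exact hv.symm
        · rw [Function.update_of_ne hil.symm]; exact hl1.symm
        · intro m hm hm'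
          rw [Function.update_of_ne hm, hl2 m hm']
      have hs := hSw.1 _ _ hb hy hd2 i hit
      rw [sw_eq_update, Function.update_self] at hs
      refine full_of_ne hSw hr i j hit hi hj hij b _ hb hs (tl_update s b i hi v).symm ?_ j hj ?_
      · have := nrm_update s b i hi v
        intro h
        apply hv
        rw [hl2 i hil]
        apply Fin.ext
        omega
      · rw [Function.update_of_ne hij]
  · left
    intro a b ha hb
    refine path_ind S (fun c => nrm s a = nrm s c) ?_ a b (hconn a b ha hb) rfl
    intro x y hx hy hd h
    rw [h]
    by_contra hne
    apply hF
    refine ⟨x, hx, ?_⟩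
    obtain ⟨l, hl1, hl2⟩ := hd_one hd
    have hls : (l : ℕ) < s := by
      by_contra hls
      apply hne
      apply Finset.sum_congr rfl
      intro m hm
      simp only [Finset.mem_filter, Finset.mem_univ, true_and] at hm
      rw [hl2]
      rintro rfl
      exact hls hm
    have htl : tl s x y := by
      intro m hm
      apply hl2
      rintro rfl
      omega
    by_cases hil : i = l
    · subst hil
      exact full_of_ne hSw hr i j hit hi hj hij x y hx hy htl hne j hj (hl2 j hij)
    · exact full_of_ne hSw hr i j hit hi hj hij x y hx hy htl hne i hi (hl2 i hil)

section Monoid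

variable {G : Type*} [CommMonoid G]

lemma pair_step {s : ℕ} {S : Set (Idx n r)} (hr : ∀ i, 2 ≤ r i) (i j : Fin n)
    (hi : (i : ℕ) < s) (hj : (j : ℕ) < s) (hij : j ≠ i) (hF : ∀ a ∈ S, Full s S a)
    (y : Idx n r → G) (H1 : ∀ a b, tl s a b → nrm s a = nrm s b → y a = y b)
    (H2 : ∀ a b, a ∈ S → b ∈ S → y a * y b = y (sw i a b) * y (sw i b a))
    (a b : Idx n r) (ha : a ∈ S) (hb : b ∈ S) (h : nrm s a < nrm s b) :
    ∃ a' b', tl s a' a ∧ tl s b' b ∧ nrm s a' + nrm s b' = nrm s a + nrm s b ∧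
      nrm s a + 1 ≤ nrm s a' ∧ nrm s a' ≤ max (nrm s a + 1) (nrm s b - 1) ∧
      y a * y b = y a' * y b' := by
  have hri := hr i
  have ht := tot_lt s hr i j hi hj hij
  have hbt := nrm_le_tot s b
  obtain ⟨α, hα⟩ : ∃ α, α = min (r i - 2) (nrm s a) := ⟨_, rfl⟩
  obtain ⟨β, hβ⟩ : ∃ β, β = max (α + 1) (nrm s b - (tot s r - (r i - 1))) := ⟨_, rfl⟩
  obtain ⟨u, u1, u2, u3⟩ := exists_comp s hr i hi a (nrm s a) α (by omega) (by omega) (by omega)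
  obtain ⟨v, v1, v2, v3⟩ := exists_comp s hr i hi b (nrm s b) β (by omega) (by omega) (by omega)
  have e1 := nrm_update s u i hi (v i)
  have e2 := nrm_update s v i hi (u i)
  refine ⟨sw i u v, sw i v u, ?_, ?_, ?_, ?_, ?_, ?_⟩
  · rw [sw_eq_update]; exact (tl_update s u i hi _).trans u1
  · rw [sw_eq_update]; exact (tl_update s v i hi _).trans v1
  · rw [sw_eq_update, sw_eq_update]; omega
  · rw [sw_eq_update]; omega
  · rw [sw_eq_update]; omega
  · rw [← H2 u v (hF a ha u u1) (hF b hb v v1), H1 u a u1 u2, H1 v b v1 v2]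

lemma pair_balance {s : ℕ} {S : Set (Idx n r)} (hr : ∀ i, 2 ≤ r i) (i j : Fin n)
    (hi : (i : ℕ) < s) (hj : (j : ℕ) < s) (hij : j ≠ i) (hF : ∀ a ∈ S, Full s S a)
    (y : Idx n r → G) (H1 : ∀ a b, tl s a b → nrm s a = nrm s b → y a = y b)
    (H2 : ∀ a b, a ∈ S → b ∈ S → y a * y b = y (sw i a b) * y (sw i b a)) :
    ∀ (N : ℕ) (a b : Idx n r), a ∈ S → b ∈ S →
      (nrm s a ≤ nrm s b + N) → (nrm s b + 1 ≤ nrm s a + N) →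
    ∃ a' b', tl s a' a ∧ tl s b' b ∧ nrm s a' + nrm s b' = nrm s a + nrm s b ∧
      (nrm s a' = nrm s b' ∨ nrm s a' = nrm s b' + 1) ∧
      y a * y b = y a' * y b' := by
  intro N
  induction N with
  | zero => intro a b ha hb h1 h2; omega
  | succ N ih =>
    intro a b ha hb h1 h2
    by_cases hdone : nrm s a = nrm s b ∨ nrm s a = nrm s b + 1
    · exact ⟨a, b, fun _ _ => rfl, fun _ _ => rfl, rfl, hdone, rfl⟩
    rcases lt_or_ge (nrm s a) (nrm s b) with h | h
    · obtain ⟨a1, b1, p1, p2, p3, p4, p5, p6⟩ :=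
        pair_step hr i j hi hj hij hF y H1 H2 a b ha hb h
      obtain ⟨a', b', q1, q2, q3, q4, q5⟩ := ih a1 b1 (hF a ha _ p1) (hF b hb _ p2)
        (by omega) (by omega)
      exact ⟨a', b', q1.trans p1, q2.trans p2, by omega, q4, p6.trans q5⟩
    · obtain ⟨b1, a1, p1, p2, p3, p4, p5, p6⟩ :=
        pair_step hr i j hi hj hij hF y H1 H2 b a hb ha (by omega)
      obtain ⟨a', b', q1, q2, q3, q4, q5⟩ := ih a1 b1 (hF a ha _ p2) (hF b hb _ p1)
        (by omega) (by omega)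
      exact ⟨a', b', q1.trans p2, q2.trans p1, by omega, q4, by
        rw [mul_comm, p6, mul_comm, q5]⟩

lemma pair_eq {s : ℕ} {S : Set (Idx n r)} (hr : ∀ i, 2 ≤ r i) (i j : Fin n)
    (hi : (i : ℕ) < s) (hj : (j : ℕ) < s) (hij : j ≠ i) (hF : ∀ a ∈ S, Full s S a)
    (y : Idx n r → G) (H1 : ∀ a b, tl s a b → nrm s a = nrm s b → y a = y b)
    (H2 : ∀ a b, a ∈ S → b ∈ S → y a * y b = y (sw i a b) * y (sw i b a))
    (a b a' b' : Idx n r) (ha : a ∈ S) (hb : b ∈ S) (ha' : tl s a' a) (hb' : tl s b' b)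
    (h : nrm s a + nrm s b = nrm s a' + nrm s b') : y a * y b = y a' * y b' := by
  obtain ⟨u, v, p1, p2, p3, p4, p5⟩ := pair_balance hr i j hi hj hij hF y H1 H2
    (nrm s a + nrm s b + 1) a b ha hb (by omega) (by omega)
  obtain ⟨u', v', q1, q2, q3, q4, q5⟩ := pair_balance hr i j hi hj hij hF y H1 H2
    (nrm s a' + nrm s b' + 1) a' b' (hF a ha _ ha') (hF b hb _ hb') (by omega) (by omega)
  rw [p5, q5, H1 u u' (p1.trans (q1.trans ha').symm) (by omega),
    H1 v v' (p2.trans (q2.trans hb').symm) (by omega)]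

lemma prod_eq {s : ℕ} {S : Set (Idx n r)} (hr : ∀ i, 2 ≤ r i) (i j : Fin n)
    (hi : (i : ℕ) < s) (hj : (j : ℕ) < s) (hij : j ≠ i) (hF : ∀ a ∈ S, Full s S a)
    (y : Idx n r → G) (H1 : ∀ a b, tl s a b → nrm s a = nrm s b → y a = y b)
    (H2 : ∀ a b, a ∈ S → b ∈ S → y a * y b = y (sw i a b) * y (sw i b a)) {d : ℕ}
    (b : Fin d → Idx n r) :
    ∀ (N : ℕ) (a : Fin d → Idx n r), (∀ l, a l ∈ S) → (∀ l, tl s (a l) (b l)) →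
      ∑ l, nrm s (a l) = ∑ l, nrm s (b l) → ∑ l, (nrm s (a l) - nrm s (b l)) ≤ N →
      ∏ l, y (a l) = ∏ l, y (b l) := by
  intro N
  induction N with
  | zero =>
    intro a ha hab hsum hN
    have hle : ∀ l ∈ Finset.univ, nrm s (a l) ≤ nrm s (b l) := by
      intro l hl
      have := Finset.single_le_sum (f := fun l => nrm s (a l) - nrm s (b l))
        (fun _ _ => Nat.zero_le _) hl
      try simp only at this
      omega
    have := (Finset.sum_eq_sum_iff_of_le hle).1 hsum
    exact Finset.prod_congr rfl fun l hl => H1 _ _ (hab l) (this l hl)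
  | succ N ih =>
    intro a ha hab hsum hN
    by_cases hall : ∀ l ∈ Finset.univ, nrm s (a l) ≤ nrm s (b l)
    · have := (Finset.sum_eq_sum_iff_of_le hall).1 hsum
      exact Finset.prod_congr rfl fun l hl => H1 _ _ (hab l) (this l hl)
    push Not at hall
    obtain ⟨p, -, hp⟩ := hall
    obtain ⟨q, hq⟩ : ∃ q, nrm s (a q) < nrm s (b q) := by
      by_contra! hc
      have := (Finset.sum_eq_sum_iff_of_le (fun l (_ : l ∈ Finset.univ) => hc l)).1 hsum.symm p
        (Finset.mem_univ p)
      omega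
    have hpq : q ≠ p := by rintro rfl; omega
    have hqm : q ∈ Finset.univ.erase p := by simp [hpq]
    have split : ∀ (M : Type) [AddCommMonoid M] (f : Fin d → M), ∑ l, f l =
        f p + (f q + ∑ l ∈ (Finset.univ.erase p).erase q, f l) := by
      intro M _ f
      rw [Finset.add_sum_erase _ f hqm, Finset.add_sum_erase _ f (Finset.mem_univ p)]
    have splitm : ∀ (f : Fin d → G), ∏ l, f l =
        f p * f q * ∏ l ∈ (Finset.univ.erase p).erase q, f l := by
      intro f
      rw [mul_assoc, Finset.mul_prod_erase _ f hqm, Finset.mul_prod_erase _ f (Finset.mem_univ p)]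
    have t1 := nrm_le_tot s (a p)
    have t2 := nrm_le_tot s (b q)
    obtain ⟨u, u1, u2⟩ := exists_nrm s (a p) hr (nrm s (a p) - 1) (by omega)
    obtain ⟨v, v1, v2⟩ := exists_nrm s (a q) hr (nrm s (a q) + 1) (by omega)
    let a' : Fin d → Idx n r := fun l => if l = p then u else if l = q then v else a l
    have ap : a' p = u := by simp [a']
    have aq : a' q = v := by simp [a', hpq]
    have ar : ∀ l ∈ (Finset.univ.erase p).erase q, a' l = a l := by
      intro l hl
      simp only [Finset.mem_erase] at hl
      simp [a', hl.1, hl.2.1]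
    have ht : ∀ l, tl s (a' l) (a l) := by
      intro l
      by_cases h1 : l = p
      · subst h1; rw [ap]; exact u1
      by_cases h2 : l = q
      · subst h2; rw [aq]; exact v1
      · rw [ar l (by simp [h1, h2])]; exact fun _ _ => rfl
    have key : ∏ l, y (a l) = ∏ l, y (a' l) := by
      rw [splitm, splitm, Finset.prod_congr rfl (fun l hl => congrArg y (ar l hl).symm), ap, aq,
        pair_eq hr i j hi hj hij hF y H1 H2 (a p) (a q) u v (ha p) (ha q) u1 v1 (by omega)]
    rw [key]
    apply ih a' (fun l => hF _ (ha l) _ (ht l)) (fun l => (ht l).trans (hab l))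
    · rw [← hsum, split _ (fun l => nrm s (a' l)), split _ (fun l => nrm s (a l)),
        Finset.sum_congr rfl (fun l hl => by rw [ar l hl]), ap, aq]
      omega
    · rw [split _ (fun l => nrm s (a l) - nrm s (b l))] at hN
      rw [split _ (fun l => nrm s (a' l) - nrm s (b l)),
        Finset.sum_congr rfl (fun l hl => by rw [ar l hl]), ap, aq]
      omega

end Monoid

end Helpers

/-- the grading map -/
noncomputable def gradeHom (k : Type) [CommRing k] (n s : ℕ) (r : Fin n → ℕ) :
    MvPolynomial (IQ n s r) k →ₐ[k] AddMonoidAlgebra k (ℕ × Multiset (Fin n → ℕ)) :=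
  MvPolynomial.aeval (fun q => Quotient.lift
    (fun a : Idx n r => AddMonoidAlgebra.of k (ℕ × Multiset (Fin n → ℕ))
      (Multiplicative.ofAdd (nrm s a, {fun i : Fin n => if s ≤ (i : ℕ) then (a i : ℕ) else 0})))
    (by
      intro a b h
      have h1 : nrm s a = nrm s b := h.1
      have h2 : (fun i : Fin n => if s ≤ (i : ℕ) then (a i : ℕ) else 0) =
          (fun i : Fin n => if s ≤ (i : ℕ) then (b i : ℕ) else 0) := by
        funext i
        split_ifs with hi
        · rw [h.2 i hi]
        · rfl
      simp only [h1, h2]) q)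

lemma gradeHom_xvar (k : Type) [CommRing k] (n s : ℕ) (r : Fin n → ℕ) (a : Idx n r) :
    gradeHom k n s r (xvar k s a) = AddMonoidAlgebra.of k (ℕ × Multiset (Fin n → ℕ))
      (Multiplicative.ofAdd
        (nrm s a, {fun i : Fin n => if s ≤ (i : ℕ) then (a i : ℕ) else 0})) := by
  unfold gradeHom xvar
  rw [MvPolynomial.aeval_X]
  rfl

lemma tailfun_eq {n s : ℕ} {r : Fin n → ℕ} {a b : Idx n r} (h : tl s a b) :
    (fun i : Fin n => if s ≤ (i : ℕ) then (a i : ℕ) else 0) =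
      (fun i : Fin n => if s ≤ (i : ℕ) then (b i : ℕ) else 0) := by
  funext i
  split_ifs with hi
  · rw [h i hi]
  · rfl

lemma ITildeS_le_ker (k : Type) [Field k] (n s t : ℕ) (r : Fin n → ℕ) (hts : t ≤ s)
    (S : Set (Idx n r)) (f : MvPolynomial (IQ n s r) k) (hf : f ∈ ITildeS k s t S) :
    gradeHom k n s r f = 0 := by
  have : ITildeS k s t S ≤ RingHom.ker (gradeHom k n s r) := by
    unfold ITildeS
    rw [Ideal.span_le]
    rintro _ ⟨i, a, b, hi, -, rfl⟩
    have his : (i : ℕ) < s := by omega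
    simp only [SetLike.mem_coe, RingHom.mem_ker]
    unfold gminor
    rw [map_sub, map_mul, map_mul, sub_eq_zero]
    simp only [gradeHom_xvar, ← map_mul, ← ofAdd_add, Prod.mk_add_mk]
    rw [sw_eq_update, sw_eq_update, tailfun_eq (tl_update s a i his _),
      tailfun_eq (tl_update s b i his _)]
    have e1 := nrm_update s a i his (b i)
    have e2 := nrm_update s b i his (a i)
    rw [show nrm s a + nrm s b = nrm s (Function.update a i (b i)) +
      nrm s (Function.update b i (a i)) by omega]
  exact this hf

lemma sum_single_eq {d : ℕ} {X : Type*} (f : Fin d → X) :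
    ∑ j, ({f j} : Multiset X) = Finset.univ.val.map f := by
  have := Multiset.sum_map_singleton (Finset.univ.val.map f)
  rw [Multiset.map_map] at this
  exact this

lemma exists_perm_of_map_eq {d : ℕ} {X : Type*} (f g : Fin d → X)
    (h : (Finset.univ.val.map f) = Finset.univ.val.map g) :
    ∃ σ : Equiv.Perm (Fin d), f = g ∘ σ := by
  classical
  have hc : ∀ x, Nonempty ({j // f j = x} ≃ {j // g j = x}) := by
    intro x
    have := congrArg (Multiset.count x) h
    rw [Multiset.count_map, Multiset.count_map] at this
    refine ⟨Fintype.equivOfCardEq ?_⟩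
    rw [Fintype.card_subtype, Fintype.card_subtype]
    simp only [eq_comm (a := x)] at this
    exact this
  have e := fun x => (hc x).some
  refine ⟨((Equiv.sigmaFiberEquiv f).symm.trans (Equiv.sigmaCongrRight e)).trans
    (Equiv.sigmaFiberEquiv g), ?_⟩
  funext j
  exact ((e (f j) ⟨j, rfl⟩).2).symm

/-- membership criterion for binomials in `Ĩ(s,t)_S`, case `t ≤ s`, `s ≥ 2`,
`S` a single connectedness class: `Π x_{a_j} − Π x_{b_j} ∈ Ĩ(s,t)_S` iff the total sums of
the first `s` components agree and the multisets of tails (components beyond `s`) agree. -/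
theorem binomial_membership_ITildeS (k : Type) [Field k] (n s t : ℕ) (r : Fin n → ℕ)
    (hr : ∀ i, 2 ≤ r i) (hs : 2 ≤ s) (hts : t ≤ s) (hsn : s ≤ n) (ht1 : 1 ≤ t)
    (S : Set (Idx n r)) (hSw : Switchable n s t r S)
    (hconn : ∀ a b, a ∈ S → b ∈ S → ConnectedIn S a b)
    (d : ℕ) (a b : Fin d → Idx n r) (ha : ∀ j, a j ∈ S) (hb : ∀ j, b j ∈ S) :
    ((∏ j, xvar k s (a j)) - ∏ j, xvar k s (b j)) ∈ ITildeS k s t S ↔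
      ((∑ j, ∑ i ∈ Finset.univ.filter (fun i : Fin n => (i : ℕ) < s), (a j i : ℕ)) =
        (∑ j, ∑ i ∈ Finset.univ.filter (fun i : Fin n => (i : ℕ) < s), (b j i : ℕ))) ∧
      (Finset.univ.val.map
          (fun j : Fin d => fun i : Fin n => if s ≤ (i : ℕ) then (a j i : ℕ) else 0)) =
        (Finset.univ.val.map
          (fun j : Fin d => fun i : Fin n => if s ≤ (i : ℕ) then (b j i : ℕ) else 0)) := by
  constructor
  · intro h
    have h0 := ITildeS_le_ker k n s t r hts S _ h
    rw [map_sub, map_prod, map_prod, sub_eq_zero] at h0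
    simp only [gradeHom_xvar, ← map_prod, ← ofAdd_sum] at h0
    have h1 := Multiplicative.ofAdd.injective (AddMonoidAlgebra.of_injective h0)
    rw [Prod.ext_iff, Prod.fst_sum, Prod.fst_sum, Prod.snd_sum, Prod.snd_sum] at h1
    refine ⟨h1.1, ?_⟩
    have h2 := h1.2
    rw [sum_single_eq, sum_single_eq] at h2
    exact h2
  · rintro ⟨h1, h2⟩
    obtain ⟨σ, hσ⟩ := exists_perm_of_map_eq _ _ h2
    rw [← Ideal.Quotient.eq, map_prod, map_prod]
    rw [← Equiv.prod_comp σ (fun l => Ideal.Quotient.mk (ITildeS k s t S) (xvar k s (b l)))]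
    have htl : ∀ l, tl s (a l) (b (σ l)) := by
      intro l i hi
      have := congrFun (congrFun hσ l) i
      simp only [Function.comp, hi, if_true] at this
      exact Fin.ext this
    have hsum : ∑ l, nrm s (a l) = ∑ l, nrm s (b (σ l)) := by
      rw [Equiv.sum_comp σ (fun l => nrm s (b l))]
      exact h1
    have H1 : ∀ x y : Idx n r, tl s x y → nrm s x = nrm s y →
        Ideal.Quotient.mk (ITildeS k s t S) (xvar k s x) =
          Ideal.Quotient.mk (ITildeS k s t S) (xvar k s y) := by
      intro x y hx hy
      have : xvar k s x = xvar k s y := by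
        unfold xvar
        congr 1
        exact Quotient.sound (s := sSetoid n s r) ⟨hy, hx⟩
      rw [this]
    have hij : (⟨1, by omega⟩ : Fin n) ≠ ⟨0, by omega⟩ := by simp
    have hit : ((⟨0, by omega⟩ : Fin n) : ℕ) < t := ht1
    have hi : ((⟨0, by omega⟩ : Fin n) : ℕ) < s := by simp; omega
    have hj : ((⟨1, by omega⟩ : Fin n) : ℕ) < s := by simp; omega
    rcases dichotomy hSw hr ⟨0, by omega⟩ ⟨1, by omega⟩ hit hi hj hij hconn with hc | hF
    · exact Finset.prod_congr rfl fun l _ => H1 _ _ (htl l) (hc _ _ (ha l) (hb _))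
    · refine prod_eq hr ⟨0, by omega⟩ ⟨1, by omega⟩ hi hj hij hF
        (fun x => Ideal.Quotient.mk (ITildeS k s t S) (xvar k s x)) H1 ?_
        (fun l => b (σ l)) _ a ha htl hsum le_rfl
      intro x y hx hy
      rw [← map_mul, ← map_mul, Ideal.Quotient.eq]
      exact Ideal.subset_span ⟨_, x, y, hit, hconn x y hx hy, rfl⟩
end

section
/- Let S be an (s,t)-switchable set consisting of one connectedness class, with s ≥ 2. Then the ideal Ĩ(s,t)_S generated by {f_{i,a,b} : i ∈ [t], a, b ∈ S} is a prime ideal of R. In particular Ĩ(s,t) = Ĩ(s,t)_N is prime. -/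
open Finset

namespace SwPrime

variable {n : ℕ} {r : Fin n → ℕ}

/-- Sum of the first `s` components. -/
def ss (s : ℕ) (a : Idx n r) : ℕ :=
  ∑ i ∈ Finset.univ.filter (fun i : Fin n => (i : ℕ) < s), (a i : ℕ)

lemma sw_eq (i : Fin n) (a b : Idx n r) : sw i a b = Function.update a i (b i) := by
  funext j
  unfold sw
  by_cases h : j = i
  · subst h; simp
  · simp [h]

lemma ss_update (s : ℕ) (a : Idx n r) (i : Fin n) (hi : (i : ℕ) < s) (v : Fin (r i)) :
    ss s (Function.update a i v) + (a i : ℕ) = ss s a + v := by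
  unfold ss
  have hm : i ∈ Finset.univ.filter (fun i : Fin n => (i : ℕ) < s) := by simp [hi]
  rw [← Finset.add_sum_erase _ _ hm, ← Finset.add_sum_erase _ (fun i => (a i : ℕ)) hm]
  have : ∑ x ∈ (Finset.univ.filter (fun i : Fin n => (i : ℕ) < s)).erase i,
      ((Function.update a i v x : Fin (r x)) : ℕ) =
      ∑ x ∈ (Finset.univ.filter (fun i : Fin n => (i : ℕ) < s)).erase i, (a x : ℕ) := by
    apply Finset.sum_congr rfl
    intro x hx
    rw [Function.update_of_ne (Finset.ne_of_mem_erase hx)]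
  rw [this]
  simp
  omega

lemma ss_update_ge (s : ℕ) (a : Idx n r) (i : Fin n) (hi : s ≤ (i : ℕ)) (v : Fin (r i)) :
    ss s (Function.update a i v) = ss s a := by
  unfold ss
  apply Finset.sum_congr rfl
  intro x hx
  simp only [Finset.mem_filter, Finset.mem_univ, true_and] at hx
  rw [Function.update_of_ne]
  rintro rfl
  omega

lemma mv (s : ℕ) (a : Idx n r) (i j : Fin n) (hi : (i : ℕ) < s) (hj : (j : ℕ) < s)
    (hij : i ≠ j) (h1 : 0 < (a i : ℕ)) (h2 : (a j : ℕ) + 1 < r j) :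
    ∃ a' : Idx n r, sEquiv n s r a a' ∧ (a' i : ℕ) + 1 = a i ∧ (a' j : ℕ) = a j + 1 := by
  have hlt := (a i).isLt
  refine ⟨Function.update (Function.update a i ⟨a i - 1, by omega⟩) j ⟨a j + 1, h2⟩,
    ⟨?_, ?_⟩, ?_, ?_⟩
  · have e1 := ss_update s a i hi ⟨a i - 1, by omega⟩
    have e2 := ss_update s (Function.update a i ⟨a i - 1, by omega⟩) j hj ⟨a j + 1, h2⟩
    rw [Function.update_of_ne hij.symm] at e2
    change ss s a = ss s _
    simp only at e1 e2
    omega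
  · intro l hl
    rw [Function.update_of_ne, Function.update_of_ne]
    · rintro rfl; omega
    · rintro rfl; omega
  · rw [Function.update_of_ne hij]
    simp
    omega
  · simp

/-- Closure properties of the sets used in the proof. -/
structure Good (s t : ℕ) (S : Set (Idx n r)) : Prop where
  upd : ∀ i : Fin n, (i : ℕ) < t → ∀ a ∈ S, ∀ b ∈ S, Function.update a i (b i) ∈ S
  eqv : ∀ a ∈ S, ∀ b, sEquiv n s r a b → b ∈ S

lemma good_of_switchable {s t : ℕ} {S : Set (Idx n r)} (h : Switchable n s t r S)
    (hc : ∀ a b, a ∈ S → b ∈ S → ConnectedIn S a b) : Good s t S := by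
  refine ⟨?_, fun a ha b hab => h.2 a b ha hab⟩
  intro i hi a ha b hb
  obtain ⟨k, c, h0, hk, hp⟩ := hc a b ha hb
  have key : ∀ d ≤ k, Function.update (c (k - d)) i (b i) ∈ S := by
    intro d
    induction d with
    | zero =>
      intro _
      have : c (k - 0) = b := by simpa using hk
      rw [this]; simpa using hb
    | succ d ih =>
      intro hd
      have h1 := ih (by omega)
      have hdist := hp.2 (k - (d + 1)) (by omega)
      have hin := hp.1 (k - (d + 1)) (by omega)
      rw [show k - (d + 1) + 1 = k - d by omega] at hdist
      generalize c (k - (d + 1)) = p at *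
      generalize c (k - d) = q at *
      unfold hammingDist at hdist
      rw [Finset.card_eq_one] at hdist
      obtain ⟨j, hj⟩ := hdist
      have hj' : ∀ x, p x ≠ q x ↔ x = j := by
        intro x
        have := Finset.ext_iff.1 hj x
        simpa using this
      by_cases hji : j = i
      · have : Function.update p i (b i) = Function.update q i (b i) := by
          funext x
          by_cases hx : x = i
          · subst hx; simp
          · rw [Function.update_of_ne hx, Function.update_of_ne hx]
            by_contra hne
            exact hx (((hj' x).1 hne).trans hji)
        rw [this]; exact h1
      · by_cases hpb : p i = b i
        · rw [← hpb]; simpa using hin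
        · have hd2 : hammingDist p (Function.update q i (b i)) = 2 := by
            unfold hammingDist
            rw [Finset.card_eq_two]
            refine ⟨j, i, hji, ?_⟩
            ext x
            simp only [Finset.mem_filter, Finset.mem_univ, true_and, Finset.mem_insert,
              Finset.mem_singleton]
            by_cases hx : x = i
            · subst hx; simp [hpb]
            · rw [Function.update_of_ne hx, hj']; simp [hx]
          have := h.1 _ _ hin h1 hd2 i hi
          rw [sw_eq] at this
          simpa using this
  have := key k le_rfl
  simpa [h0] using this

lemma full_aux {s t : ℕ} {S : Set (Idx n r)} (hS : Good s t S) (hr : ∀ i, 2 ≤ r i)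
    (z o : Fin n) (hzo : z ≠ o) (hzs : (z : ℕ) < s) (hzt : (z : ℕ) < t) (hos : (o : ℕ) < s)
    (hE : ∃ a ∈ S, ∃ b ∈ S, a z ≠ b z) : ∀ v : Fin (r z), ∃ a ∈ S, a z = v := by
  obtain ⟨P, hP, Q, hQ, hPQ⟩ : ∃ P ∈ S, ∃ Q ∈ S, (P z : ℕ) < Q z := by
    obtain ⟨a, ha, b, hb, hab⟩ := hE
    have : (a z : ℕ) ≠ b z := fun h => hab (Fin.ext h)
    rcases Nat.lt_or_gt_of_ne this with h | h
    · exact ⟨a, ha, b, hb, h⟩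
    · exact ⟨b, hb, a, ha, h⟩
  have hQl := (Q z).isLt
  have hro := hr o
  have up : ∀ c ∈ S, (c z : ℕ) + 1 < r z → ∃ g ∈ S, (g z : ℕ) = c z + 1 := by
    intro c hc hcz
    obtain ⟨D, hD, hDo⟩ : ∃ D ∈ S, 0 < (D o : ℕ) := by
      by_cases hq : (Q o : ℕ) + 1 < r o
      · obtain ⟨D, hD, h1, h2⟩ := mv s Q z o hzs hos hzo (by omega) hq
        exact ⟨D, hS.eqv _ hQ _ hD, by omega⟩
      · exact ⟨Q, hQ, by omega⟩
    have hg := hS.upd z hzt D hD c hc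
    obtain ⟨g, hg', h1, h2⟩ := mv s (Function.update D z (c z)) o z hos hzs hzo.symm
      (by rw [Function.update_of_ne hzo.symm]; exact hDo) (by simpa using hcz)
    exact ⟨g, hS.eqv _ hg _ hg', by simpa using h2⟩
  have down : ∀ c ∈ S, 0 < (c z : ℕ) → ∃ g ∈ S, (g z : ℕ) + 1 = c z := by
    intro c hc hcz
    obtain ⟨D, hD, hDo⟩ : ∃ D ∈ S, (D o : ℕ) + 1 < r o := by
      by_cases hq : 0 < (P o : ℕ)
      · obtain ⟨D, hD, h1, h2⟩ := mv s P o z hos hzs hzo.symm hq (by omega)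
        have := (P o).isLt
        exact ⟨D, hS.eqv _ hP _ hD, by omega⟩
      · exact ⟨P, hP, by omega⟩
    have hg := hS.upd z hzt D hD c hc
    obtain ⟨g, hg', h1, h2⟩ := mv s (Function.update D z (c z)) z o hzs hos hzo
      (by simpa using hcz) (by rw [Function.update_of_ne hzo.symm]; exact hDo)
    exact ⟨g, hS.eqv _ hg _ hg', by simpa using h1⟩
  have up' : ∀ d : ℕ, ∀ c ∈ S, (c z : ℕ) + d < r z → ∃ g ∈ S, (g z : ℕ) = c z + d := by
    intro d
    induction d with
    | zero => intro c hc _; exact ⟨c, hc, rfl⟩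
    | succ d ih =>
      intro c hc h
      obtain ⟨g, hg, h1⟩ := ih c hc (by omega)
      obtain ⟨g', hg', h2⟩ := up g hg (by omega)
      exact ⟨g', hg', by omega⟩
  have down' : ∀ d : ℕ, ∀ c ∈ S, (c z : ℕ) = d → ∃ g ∈ S, (g z : ℕ) = 0 := by
    intro d
    induction d with
    | zero => intro c hc h; exact ⟨c, hc, h⟩
    | succ d ih =>
      intro c hc h
      obtain ⟨g, hg, h1⟩ := down c hc (by omega)
      exact ih g hg (by omega)
  intro v
  obtain ⟨g, hg, h0⟩ := down' _ P hP rfl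
  obtain ⟨g', hg', h1⟩ := up' v g hg (by rw [h0]; have := v.isLt; omega)
  exact ⟨g', hg', Fin.ext (by omega)⟩

lemma full {s t : ℕ} {S : Set (Idx n r)} (hS : Good s t S) (hr : ∀ i, 2 ≤ r i)
    (z o : Fin n) (hzo : z ≠ o) (hzs : (z : ℕ) < s) (hzt : (z : ℕ) < t) (hos : (o : ℕ) < s)
    (a b : Idx n r) (ha : a ∈ S) (hb : b ∈ S) (hab : ss s a < ss s b) :
    ∀ c ∈ S, ∀ v : Fin (r z), Function.update c z v ∈ S := by
  have hE : ∃ a ∈ S, ∃ b ∈ S, a z ≠ b z := by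
    by_contra hcon
    push Not at hcon
    obtain ⟨j, hj, hlt⟩ := Finset.exists_lt_of_sum_lt hab
    simp only [Finset.mem_filter, Finset.mem_univ, true_and] at hj
    have hzj : z ≠ j := by
      rintro rfl
      rw [hcon a ha b hb] at hlt
      omega
    have hbj := (b j).isLt
    by_cases h0 : 0 < (a z : ℕ)
    · obtain ⟨a', h1, h2, h3⟩ := mv s a z j hzs hj hzj h0 (by omega)
      have := hcon a ha a' (hS.eqv _ ha _ h1)
      rw [← this] at h2
      omega
    · have e := hcon a ha b hb
      have hrz := hr z
      obtain ⟨a', h1, h2, h3⟩ := mv s b j z hj hzs hzj.symm (by omega) (by rw [← e]; omega)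
      have := hcon b hb a' (hS.eqv _ hb _ h1)
      rw [← this] at h3
      omega
  intro c hc v
  obtain ⟨d, hd, rfl⟩ := full_aux hS hr z o hzo hzs hzt hos hE v
  exact hS.upd z hzt c hc d hd

/-- The ideal generated by the minors with indices in `S`. -/
noncomputable def J (k : Type) [CommRing k] (s t : ℕ) (S : Set (Idx n r)) :
    Ideal (MvPolynomial (IQ n s r) k) :=
  Ideal.span {f | ∃ i : Fin n, ∃ a b : Idx n r,
    (i : ℕ) < t ∧ a ∈ S ∧ b ∈ S ∧ f = gminor k s i a b}

lemma xvar_congr (k : Type) [CommRing k] {s : ℕ} {a b : Idx n r} (h : sEquiv n s r a b) :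
    xvar k s a = xvar k s b := by
  unfold xvar
  congr 1
  exact Quotient.sound h

lemma symmE {s : ℕ} {a b : Idx n r} (h : sEquiv n s r a b) : sEquiv n s r b a :=
  (sSetoid n s r).symm h

lemma transE {s : ℕ} {a b c : Idx n r} (h : sEquiv n s r a b) (g : sEquiv n s r b c) :
    sEquiv n s r a c :=
  (sSetoid n s r).trans h g

/-- The unit step relation. -/
lemma unit_step (k : Type) [CommRing k] {s t : ℕ} {S : Set (Idx n r)} (hS : Good s t S)
    (hr : ∀ i, 2 ≤ r i)
    (z o : Fin n) (hzo : z ≠ o) (hzs : (z : ℕ) < s) (hzt : (z : ℕ) < t) (hos : (o : ℕ) < s)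
    (hfull : ∀ c ∈ S, ∀ v : Fin (r z), Function.update c z v ∈ S)
    (a b : Idx n r) (ha : a ∈ S) (hb : b ∈ S)
    (h1 : ∃ j : Fin n, (j : ℕ) < s ∧ (a j : ℕ) + 1 < r j)
    (h2 : ∃ j : Fin n, (j : ℕ) < s ∧ 0 < (b j : ℕ)) :
    ∃ a' ∈ S, ∃ b' ∈ S, ss s a' = ss s a + 1 ∧ ss s b' + 1 = ss s b ∧
      (∀ l : Fin n, s ≤ (l : ℕ) → a' l = a l) ∧ (∀ l : Fin n, s ≤ (l : ℕ) → b' l = b l) ∧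
      xvar k s a * xvar k s b - xvar k s a' * xvar k s b' ∈ J k s t S := by
  obtain ⟨A, hA, hAz⟩ : ∃ A, sEquiv n s r a A ∧ (A z : ℕ) + 1 < r z := by
    obtain ⟨j, hj, hj2⟩ := h1
    by_cases hz : (a z : ℕ) + 1 < r z
    · exact ⟨a, (sSetoid n s r).refl a, hz⟩
    · have hne : z ≠ j := by rintro rfl; exact hz hj2
      have := hr z
      have := (a z).isLt
      obtain ⟨A, h, h', _⟩ := mv s a z j hzs hj hne (by omega) hj2
      exact ⟨A, h, by omega⟩
  obtain ⟨B, hB, hBo⟩ : ∃ B, sEquiv n s r b B ∧ 0 < (B o : ℕ) := by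
    obtain ⟨j, hj, hj2⟩ := h2
    by_cases hz : 0 < (b o : ℕ)
    · exact ⟨b, (sSetoid n s r).refl b, hz⟩
    · have hne : j ≠ o := by rintro rfl; exact hz hj2
      have := hr o
      obtain ⟨A, h, _, h'⟩ := mv s b j o hj hos hne hj2 (by omega)
      exact ⟨A, h, by omega⟩
  have hAS := hS.eqv _ ha _ hA
  have hBS := hS.eqv _ hb _ hB
  have hBl := (B o).isLt
  have hBz := (B z).isLt
  have hrz := hr z
  set B' : Idx n r := Function.update B o ⟨B o - 1, by omega⟩ with hB'
  have sB' := ss_update s B o hos ⟨B o - 1, by omega⟩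
  rw [← hB'] at sB'
  simp only at sB'
  have restB' : ∀ l : Fin n, s ≤ (l : ℕ) → B' l = B l := by
    intro l hl
    rw [hB', Function.update_of_ne]
    rintro rfl; omega
  have hB'z : B' z = B z := by rw [hB', Function.update_of_ne hzo]
  have hB'S : B' ∈ S := by
    by_cases hz : (B z : ℕ) + 1 < r z
    · have key : Function.update B' z ⟨B z + 1, hz⟩ ∈ S := by
        refine hS.eqv _ hBS _ ⟨?_, ?_⟩
        · have e := ss_update s B' z hzs ⟨B z + 1, hz⟩
          rw [hB'z] at e
          change ss s B = ss s _
          simp only at e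
          omega
        · intro l hl
          rw [Function.update_of_ne, restB' l hl]
          rintro rfl; omega
      have := hfull _ key (B z)
      rw [Function.update_idem, ← hB'z, Function.update_eq_self] at this
      exact this
    · have h3 := hfull _ hBS ⟨B z - 1, by omega⟩
      refine hS.eqv _ h3 _ ⟨?_, ?_⟩
      · have e := ss_update s B z hzs ⟨B z - 1, by omega⟩
        change ss s _ = ss s B'
        simp only at e
        omega
      · intro l hl
        rw [Function.update_of_ne, restB' l hl]
        rintro rfl; omega
  set A' : Idx n r := Function.update A z ⟨A z + 1, hAz⟩ with hA'
  have sA' := ss_update s A z hzs ⟨A z + 1, hAz⟩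
  rw [← hA'] at sA'
  simp only at sA'
  have hA'S : A' ∈ S := hfull _ hAS _
  have ea : ss s a = ss s A := hA.1
  have eb : ss s b = ss s B := hB.1
  refine ⟨A', hA'S, B', hB'S, by omega, by omega, ?_, ?_, ?_⟩
  · intro l hl
    rw [hA.2 l hl, hA', Function.update_of_ne]
    rintro rfl; omega
  · intro l hl
    rw [hB.2 l hl, restB' l hl]
  · have g1 : gminor k s z A B ∈ J k s t S :=
      Ideal.subset_span ⟨z, A, B, hzt, hAS, hBS, rfl⟩
    have g2 : gminor k s z A' B' ∈ J k s t S :=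
      Ideal.subset_span ⟨z, A', B', hzt, hA'S, hB'S, rfl⟩
    have e1 : sw z A B = sw z A' B' := by
      rw [sw_eq, sw_eq, hA', Function.update_idem, hB'z]
    have e2 : sEquiv n s r (sw z B A) (sw z B' A') := by
      rw [sw_eq, sw_eq]
      refine ⟨?_, ?_⟩
      · have u1 := ss_update s B z hzs (A z)
        have u2 := ss_update s B' z hzs (A' z)
        have : (A' z : ℕ) = A z + 1 := by simp [hA']
        rw [hB'z] at u2
        change ss s _ = ss s _
        omega
      · intro l hl
        rw [Function.update_of_ne, Function.update_of_ne, restB' l hl]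
        · rintro rfl; omega
        · rintro rfl; omega
    have := sub_mem g1 g2
    unfold gminor at this
    rw [← e1, ← xvar_congr k e2, sub_sub_sub_cancel_right] at this
    rw [xvar_congr k hA, xvar_congr k hB]
    exact this

end SwPrime

namespace SwPrime

open MvPolynomial

/-- An ideal containing all binomials of equal weight, and contained in the kernel of the
monomial map, is prime. -/
lemma toric_prime {σ τ k : Type} [Field k] (w : σ → τ →₀ ℕ) (I : Ideal (MvPolynomial σ k))
    (h1 : I ≤ RingHom.ker (aeval (fun q => monomial (w q) (1 : k)) :
      MvPolynomial σ k →ₐ[k] MvPolynomial τ k))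
    (h2 : ∀ m m' : Multiset σ, (m.map w).sum = (m'.map w).sum →
      (m.map (X : σ → MvPolynomial σ k)).prod - (m'.map X).prod ∈ I) : I.IsPrime := by
  classical
  set φ : MvPolynomial σ k →ₐ[k] MvPolynomial τ k :=
    aeval (fun q => monomial (w q) (1 : k)) with hφ
  have hX : ∀ m : Multiset σ, φ (m.map X).prod = monomial (m.map w).sum (1 : k) := by
    intro m
    induction m using Multiset.induction_on with
    | empty => simp
    | cons q m ih =>
      simp only [Multiset.map_cons, Multiset.prod_cons, Multiset.sum_cons, map_mul, ih]
      rw [hφ, aeval_X, monomial_mul, one_mul]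
  have hmon : ∀ m : σ →₀ ℕ,
      (monomial m (1 : k)) = ((Finsupp.toMultiset m).map (X : σ → MvPolynomial σ k)).prod := by
    intro m
    rw [Finsupp.toMultiset_map, Finsupp.prod_toMultiset,
      Finsupp.prod_mapDomain_index (fun _ => pow_zero _) (fun _ _ _ => pow_add _ _ _),
      monomial_eq]
    simp
  -- a choice of a multiset for every weight
  let nf : (τ →₀ ℕ) → Multiset σ := fun u =>
    if h : ∃ m : Multiset σ, (m.map w).sum = u then h.choose else 0
  have hnf : ∀ m : Multiset σ, ((nf (m.map w).sum).map w).sum = (m.map w).sum := by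
    intro m
    have h : ∃ m' : Multiset σ, (m'.map w).sum = (m.map w).sum := ⟨m, rfl⟩
    simp only [nf, dif_pos h]
    exact h.choose_spec
  let L : MvPolynomial τ k →ₗ[k] MvPolynomial σ k :=
    (MvPolynomial.basisMonomials τ k).constr k
      (fun u => ((nf u).map (X : σ → MvPolynomial σ k)).prod)
  have hL : ∀ u, L (monomial u (1 : k)) = ((nf u).map (X : σ → MvPolynomial σ k)).prod := by
    intro u
    have := (MvPolynomial.basisMonomials τ k).constr_basis k
      (fun u => ((nf u).map (X : σ → MvPolynomial σ k)).prod) u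
    rwa [MvPolynomial.coe_basisMonomials] at this
  have key : ∀ p : MvPolynomial σ k, p - L (φ p) ∈ I := by
    intro p
    induction p using MvPolynomial.induction_on' with
    | monomial m c =>
      have e : monomial m c = c • monomial m (1 : k) := by
        rw [smul_monomial, smul_eq_mul, mul_one]
      rw [e, map_smul, map_smul, ← smul_sub, hmon, hX, hL, MvPolynomial.smul_eq_C_mul]
      apply Ideal.mul_mem_left
      exact h2 _ _ (hnf _).symm
    | add p q hp hq =>
      rw [map_add, map_add]
      have := add_mem hp hq
      convert this using 1
      ring
  have : I = RingHom.ker φ := by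
    apply le_antisymm h1
    intro p hp
    have h := key p
    rw [RingHom.mem_ker] at hp
    rw [hp, map_zero, sub_zero] at h
    exact h
  rw [this]
  exact RingHom.ker_isPrime _

variable {n : ℕ} {r : Fin n → ℕ}

/-- Index type of the variables of the target of the monomial map. -/
abbrev Tau (n s t : ℕ) (r : Fin n → ℕ) : Type :=
  Bool ⊕ (Σ i : Fin n, Fin (r i)) ⊕
    (∀ j : {j : Fin n // s ≤ (j : ℕ) ∧ t ≤ (j : ℕ)}, Fin (r j)) ⊕ IQ n s r

/-- The maximal value of `ss`. -/
def MM (s : ℕ) (r : Fin n → ℕ) : ℕ :=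
  ∑ i ∈ Finset.univ.filter (fun i : Fin n => (i : ℕ) < s), (r i - 1)

lemma ss_le (s : ℕ) (a : Idx n r) : ss s a ≤ MM s r := by
  apply Finset.sum_le_sum
  intro i _
  have := (a i).isLt
  omega

open Classical in
/-- The exponent vector of the image of the variable `x_a`. -/
noncomputable def wf (s t : ℕ) (S : Set (Idx n r)) (a : Idx n r) : Tau n s t r → ℕ
  | Sum.inl true => if a ∈ S then ss s a else 0
  | Sum.inl false => if a ∈ S then MM s r - ss s a else 0
  | Sum.inr (Sum.inl x) => if a ∈ S ∧ s ≤ (x.1 : ℕ) ∧ (x.1 : ℕ) < t ∧ a x.1 = x.2 then 1 else 0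
  | Sum.inr (Sum.inr (Sum.inl v)) => if a ∈ S ∧ (∀ j, a j.1 = v j) then 1 else 0
  | Sum.inr (Sum.inr (Sum.inr q)) => if a ∉ S ∧ Quotient.mk (sSetoid n s r) a = q then 1 else 0

lemma wf_congr {s t : ℕ} {S : Set (Idx n r)} (hS : Good s t S) (a b : Idx n r)
    (h : sEquiv n s r a b) : wf s t S a = wf s t S b := by
  have hm : a ∈ S ↔ b ∈ S := ⟨fun ha => hS.eqv _ ha _ h, fun hb => hS.eqv _ hb _ (symmE h)⟩
  have hs : ss s a = ss s b := h.1
  have hq : Quotient.mk (sSetoid n s r) a = Quotient.mk (sSetoid n s r) b := Quotient.sound h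
  funext x
  by_cases ha : a ∈ S
  · have hb := hm.1 ha
    rcases x with (_ | _) | ⟨j, v⟩ | v | q
    · simp only [wf, ha, hb, hs]
    · simp only [wf, ha, hb, hs]
    · simp only [wf, ha, hb, true_and]
      by_cases hj : s ≤ (j : ℕ)
      · rw [h.2 j hj]
      · simp [hj]
    · simp only [wf, ha, hb, true_and]
      have e : (∀ j : {j : Fin n // s ≤ (j : ℕ) ∧ t ≤ (j : ℕ)}, a j.1 = v j) ↔
          (∀ j : {j : Fin n // s ≤ (j : ℕ) ∧ t ≤ (j : ℕ)}, b j.1 = v j) :=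
        forall_congr' fun j => by rw [h.2 _ j.2.1]
      simp only [e]
    · simp only [wf, ha, hb, not_true_eq_false, false_and, if_false]
  · have hb : b ∉ S := fun hb => ha (hm.2 hb)
    rcases x with (_ | _) | ⟨j, v⟩ | v | q
    · simp only [wf, ha, hb, if_false]
    · simp only [wf, ha, hb, if_false]
    · simp only [wf, ha, hb, false_and, if_false]
    · simp only [wf, ha, hb, false_and, if_false]
    · simp only [wf]
      classical
      by_cases hbq : Quotient.mk (sSetoid n s r) b = q
      · rw [if_pos ⟨ha, hq.trans hbq⟩, if_pos ⟨hb, hbq⟩]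
      · rw [if_neg (fun h => hbq (hq.symm.trans h.2)), if_neg (fun h => hbq h.2)]

/-- The exponent vector, as a function on the variables of `R`. -/
noncomputable def W {s t : ℕ} {S : Set (Idx n r)} (hS : Good s t S) (q : IQ n s r) :
    Tau n s t r →₀ ℕ :=
  Finsupp.equivFunOnFinite.symm (Quotient.lift (wf s t S) (wf_congr hS) q)

lemma W_mk {s t : ℕ} {S : Set (Idx n r)} (hS : Good s t S) (a : Idx n r) (x : Tau n s t r) :
    W hS (Quotient.mk (sSetoid n s r) a) x = wf s t S a x := rfl

lemma wf_sw {s t : ℕ} {S : Set (Idx n r)} (hS : Good s t S) (i : Fin n) (hi : (i : ℕ) < t)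
    (a b : Idx n r) (ha : a ∈ S) (hb : b ∈ S) (x : Tau n s t r) :
    wf s t S a x + wf s t S b x = wf s t S (sw i a b) x + wf s t S (sw i b a) x := by
  rw [sw_eq, sw_eq]
  have ha' := hS.upd i hi a ha b hb
  have hb' := hS.upd i hi b hb a ha
  have hss : ss s a + ss s b =
      ss s (Function.update a i (b i)) + ss s (Function.update b i (a i)) := by
    by_cases his : (i : ℕ) < s
    · have u1 := ss_update s a i his (b i)
      have u2 := ss_update s b i his (a i)
      omega
    · rw [ss_update_ge s a i (by omega), ss_update_ge s b i (by omega)]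
  have l1 := ss_le s a
  have l2 := ss_le s b
  have l3 := ss_le s (Function.update a i (b i))
  have l4 := ss_le s (Function.update b i (a i))
  rcases x with (_ | _) | ⟨j, v⟩ | v | q
  · simp only [wf, ha, hb, ha', hb', if_true]
    omega
  · simp only [wf, ha, hb, ha', hb', if_true]
    omega
  · simp only [wf, ha, hb, ha', hb', true_and]
    by_cases hj : j = i
    · subst hj
      simp only [Function.update_self]
      omega
    · rw [Function.update_of_ne hj, Function.update_of_ne hj]
  · simp only [wf, ha, hb, ha', hb', true_and]
    have hne : ∀ j : {j : Fin n // s ≤ (j : ℕ) ∧ t ≤ (j : ℕ)}, j.1 ≠ i := by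
      intro j hj
      have h2 := j.2.2
      rw [hj] at h2
      omega
    have e1 : ∀ j : {j : Fin n // s ≤ (j : ℕ) ∧ t ≤ (j : ℕ)},
        Function.update a i (b i) j.1 = a j.1 := fun j => Function.update_of_ne (hne j) _ _
    have e2 : ∀ j : {j : Fin n // s ≤ (j : ℕ) ∧ t ≤ (j : ℕ)},
        Function.update b i (a i) j.1 = b j.1 := fun j => Function.update_of_ne (hne j) _ _
    simp only [e1, e2]
  · simp only [wf, ha, hb, ha', hb', not_true_eq_false, false_and, if_false]

lemma wf_unit {s t : ℕ} {S : Set (Idx n r)}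
    (a b a' b' : Idx n r) (ha : a ∈ S) (hb : b ∈ S) (ha' : a' ∈ S) (hb' : b' ∈ S)
    (hss : ss s a + ss s b = ss s a' + ss s b')
    (h1 : ∀ l : Fin n, s ≤ (l : ℕ) → a' l = a l) (h2 : ∀ l : Fin n, s ≤ (l : ℕ) → b' l = b l)
    (x : Tau n s t r) :
    wf s t S a x + wf s t S b x = wf s t S a' x + wf s t S b' x := by
  have l1 := ss_le s a
  have l2 := ss_le s b
  have l3 := ss_le s a'
  have l4 := ss_le s b'
  rcases x with (_ | _) | ⟨j, v⟩ | v | q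
  · simp only [wf, ha, hb, ha', hb', if_true]
    omega
  · simp only [wf, ha, hb, ha', hb', if_true]
    omega
  · simp only [wf, ha, hb, ha', hb', true_and]
    by_cases hj : s ≤ (j : ℕ)
    · rw [h1 j hj, h2 j hj]
    · simp [hj]
  · simp only [wf, ha, hb, ha', hb', true_and]
    have e1 : ∀ j : {j : Fin n // s ≤ (j : ℕ) ∧ t ≤ (j : ℕ)}, a' j.1 = a j.1 :=
      fun j => h1 _ j.2.1
    have e2 : ∀ j : {j : Fin n // s ≤ (j : ℕ) ∧ t ≤ (j : ℕ)}, b' j.1 = b j.1 :=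
      fun j => h2 _ j.2.1
    simp only [e1, e2]
  · simp only [wf, ha, hb, ha', hb', not_true_eq_false, false_and, if_false]

lemma exists_of_sum_ne {σ τ : Type} (w : σ → τ →₀ ℕ) (m : Multiset σ) (x : τ)
    (h : (m.map w).sum x ≠ 0) : ∃ q ∈ m, w q x ≠ 0 := by
  induction m using Multiset.induction_on with
  | empty => simp at h
  | cons q m ih =>
    rw [Multiset.map_cons, Multiset.sum_cons, Finsupp.add_apply] at h
    by_cases hq : w q x = 0
    · obtain ⟨p, hp, hp'⟩ := ih (by omega)
      exact ⟨p, Multiset.mem_cons_of_mem hp, hp'⟩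
    · exact ⟨q, Multiset.mem_cons_self _ _, hq⟩

/-- Two multisets of variables have the same weight and congruent products. -/
def Rel (k : Type) [Field k] {s t : ℕ} {S : Set (Idx n r)} (hS : Good s t S)
    (m m' : Multiset (IQ n s r)) : Prop :=
  (m.map (W hS)).sum = (m'.map (W hS)).sum ∧
  (m.map (X : IQ n s r → MvPolynomial (IQ n s r) k)).prod - (m'.map X).prod ∈ J k s t S

lemma Rel.trans {k : Type} [Field k] {s t : ℕ} {S : Set (Idx n r)} {hS : Good s t S}
    {m m' m'' : Multiset (IQ n s r)} (h : Rel k hS m m') (g : Rel k hS m' m'') :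
    Rel k hS m m'' := by
  refine ⟨h.1.trans g.1, ?_⟩
  have := add_mem h.2 g.2
  rwa [sub_add_sub_cancel] at this

lemma Rel.refl (k : Type) [Field k] {s t : ℕ} {S : Set (Idx n r)} (hS : Good s t S)
    (m : Multiset (IQ n s r)) : Rel k hS m m := ⟨rfl, by simp⟩

lemma Rel.pair {k : Type} [Field k] {s t : ℕ} {S : Set (Idx n r)} {hS : Good s t S}
    (a b a' b' : Idx n r) (m : Multiset (IQ n s r))
    (h1 : ∀ x, wf s t S a x + wf s t S b x = wf s t S a' x + wf s t S b' x)
    (h2 : xvar k s a * xvar k s b - xvar k s a' * xvar k s b' ∈ J k s t S) :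
    Rel k hS (Quotient.mk (sSetoid n s r) a ::ₘ Quotient.mk (sSetoid n s r) b ::ₘ m)
      (Quotient.mk (sSetoid n s r) a' ::ₘ Quotient.mk (sSetoid n s r) b' ::ₘ m) := by
  constructor
  · simp only [Multiset.map_cons, Multiset.sum_cons, ← add_assoc]
    congr 1
    ext x
    exact h1 x
  · simp only [Multiset.map_cons, Multiset.prod_cons, ← mul_assoc, ← sub_mul]
    exact Ideal.mul_mem_right _ _ h2

lemma step1 (k : Type) [Field k] {s t : ℕ} {S : Set (Idx n r)} (hS : Good s t S)
    (a : Idx n r) (ha : a ∈ S) (m m' : Multiset (IQ n s r))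
    (hw : (m'.map (W hS)).sum = W hS (Quotient.mk (sSetoid n s r) a) + (m.map (W hS)).sum)
    (F : Finset (Fin n)) (hF : ∀ i ∈ F, s ≤ (i : ℕ) ∧ (i : ℕ) < t) :
    ∃ b ∈ S, ∃ m0, Rel k hS m' (Quotient.mk (sSetoid n s r) b ::ₘ m0) ∧
      (∀ i ∈ F, b i = a i) ∧ (∀ i : Fin n, s ≤ (i : ℕ) → t ≤ (i : ℕ) → b i = a i) := by
  classical
  induction F using Finset.induction_on with
  | empty =>
    have h0 : (m'.map (W hS)).sum (Sum.inr (Sum.inr (Sum.inl fun j => a j.1))) ≠ 0 := by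
      rw [hw, Finsupp.add_apply, W_mk]
      simp [wf, ha]
    obtain ⟨q, hq, hq'⟩ := exists_of_sum_ne _ _ _ h0
    induction q using Quotient.inductionOn with
    | h b =>
      rw [W_mk] at hq'
      simp only [wf, ne_eq, ite_eq_right_iff, one_ne_zero, imp_false, not_not] at hq'
      obtain ⟨m0, rfl⟩ := Multiset.exists_cons_of_mem hq
      exact ⟨b, hq'.1, m0, Rel.refl k hS _, by simp, fun i h1 h2 => hq'.2 ⟨i, h1, h2⟩⟩
  | insert i F hi ih =>
    obtain ⟨b, hb, m0, hrel, hbF, hbr⟩ := ih (fun j hj => hF j (Finset.mem_insert_of_mem hj))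
    obtain ⟨his, hit⟩ := hF i (Finset.mem_insert_self _ _)
    by_cases hbi : b i = a i
    · refine ⟨b, hb, m0, hrel, ?_, hbr⟩
      intro j hj
      rcases Finset.mem_insert.1 hj with rfl | hj
      · exact hbi
      · exact hbF j hj
    · have h0 : (m0.map (W hS)).sum (Sum.inr (Sum.inl ⟨i, a i⟩)) ≠ 0 := by
        have e := hrel.1.symm.trans hw
        have e' := DFunLike.congr_fun e (Sum.inr (Sum.inl ⟨i, a i⟩))
        rw [Multiset.map_cons, Multiset.sum_cons, Finsupp.add_apply, Finsupp.add_apply,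
          W_mk, W_mk] at e'
        simp only [wf, ha, his, hit, hbi, and_false, if_false, and_true, if_true] at e'
        omega
      obtain ⟨q, hq, hq'⟩ := exists_of_sum_ne _ _ _ h0
      induction q using Quotient.inductionOn with
      | h c =>
        rw [W_mk] at hq'
        simp only [wf, ne_eq, ite_eq_right_iff, one_ne_zero, imp_false, not_not] at hq'
        obtain ⟨hc, -, -, hci⟩ := hq'
        obtain ⟨m1, rfl⟩ := Multiset.exists_cons_of_mem hq
        refine ⟨sw i b c, by rw [sw_eq]; exact hS.upd i hit b hb c hc, _,
          hrel.trans (Rel.pair b c (sw i b c) (sw i c b) m1 (wf_sw hS i hit b c hb hc) ?_),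
          ?_, ?_⟩
        · exact Ideal.subset_span ⟨i, b, c, hit, hb, hc, rfl⟩
        · intro j hj
          rw [sw_eq]
          rcases Finset.mem_insert.1 hj with rfl | hj'
          · simpa using hci
          · rw [Function.update_of_ne, hbF j hj']
            rintro rfl
            exact hi hj'
        · intro j h1 h2
          rw [sw_eq, Function.update_of_ne, hbr j h1 h2]
          rintro rfl
          omega

lemma step2 (k : Type) [Field k] {s t : ℕ} {S : Set (Idx n r)} (hS : Good s t S)
    (hr : ∀ i, 2 ≤ r i)
    (z o : Fin n) (hzo : z ≠ o) (hzs : (z : ℕ) < s) (hzt : (z : ℕ) < t) (hos : (o : ℕ) < s)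
    (a : Idx n r) (ha : a ∈ S) (m m' : Multiset (IQ n s r))
    (hw : (m'.map (W hS)).sum = W hS (Quotient.mk (sSetoid n s r) a) + (m.map (W hS)).sum)
    (d : ℕ) : ∀ b ∈ S, ∀ m0, Rel k hS m' (Quotient.mk (sSetoid n s r) b ::ₘ m0) →
      (∀ i : Fin n, s ≤ (i : ℕ) → b i = a i) →
      (ss s b + d = ss s a ∨ ss s a + d = ss s b) →
      ∃ m'', Rel k hS m' (Quotient.mk (sSetoid n s r) a ::ₘ m'') := by
  induction d with
  | zero =>
    intro b hb m0 hrel hba hd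
    have : Quotient.mk (sSetoid n s r) b = Quotient.mk (sSetoid n s r) a :=
      Quotient.sound ⟨show ss s b = ss s a by omega, hba⟩
    exact ⟨m0, this ▸ hrel⟩
  | succ d ih =>
    intro b hb m0 hrel hba hd
    have e := hrel.1.symm.trans hw
    have la := ss_le s a
    have lb := ss_le s b
    rcases hd with hd | hd
    · have hfull := full hS hr z o hzo hzs hzt hos b a hb ha (by omega)
      have h0 : (m0.map (W hS)).sum (Sum.inl true) ≠ 0 := by
        have e' := DFunLike.congr_fun e (Sum.inl true)
        rw [Multiset.map_cons, Multiset.sum_cons, Finsupp.add_apply, Finsupp.add_apply,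
          W_mk, W_mk] at e'
        simp only [wf, ha, hb, if_true] at e'
        omega
      obtain ⟨q, hq, hq'⟩ := exists_of_sum_ne _ _ _ h0
      induction q using Quotient.inductionOn with
      | h c =>
        rw [W_mk] at hq'
        simp only [wf, ne_eq, ite_eq_right_iff, Classical.not_imp] at hq'
        obtain ⟨hc, hc0⟩ := hq'
        obtain ⟨m1, rfl⟩ := Multiset.exists_cons_of_mem hq
        have g1 : ∃ j : Fin n, (j : ℕ) < s ∧ (b j : ℕ) + 1 < r j := by
          have : ss s b < MM s r := by omega
          obtain ⟨j, hj, hlt⟩ := Finset.exists_lt_of_sum_lt this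
          exact ⟨j, by simpa using hj, by omega⟩
        have g2 : ∃ j : Fin n, (j : ℕ) < s ∧ 0 < (c j : ℕ) := by
          obtain ⟨j, hj, hlt⟩ := Finset.exists_ne_zero_of_sum_ne_zero hc0
          exact ⟨j, by simpa using hj, by omega⟩
        obtain ⟨b', hb', c', hc', s1, s2, r1, r2, hI⟩ :=
          unit_step k hS hr z o hzo hzs hzt hos hfull b c hb hc g1 g2
        refine ih b' hb' _ (hrel.trans (Rel.pair b c b' c' m1
          (wf_unit b c b' c' hb hc hb' hc' (by omega) r1 r2) hI)) ?_ (by omega)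
        intro i hi
        rw [r1 i hi, hba i hi]
    · have hfull := full hS hr z o hzo hzs hzt hos a b ha hb (by omega)
      have h0 : (m0.map (W hS)).sum (Sum.inl false) ≠ 0 := by
        have e' := DFunLike.congr_fun e (Sum.inl false)
        rw [Multiset.map_cons, Multiset.sum_cons, Finsupp.add_apply, Finsupp.add_apply,
          W_mk, W_mk] at e'
        simp only [wf, ha, hb, if_true] at e'
        omega
      obtain ⟨q, hq, hq'⟩ := exists_of_sum_ne _ _ _ h0
      induction q using Quotient.inductionOn with
      | h c =>
        rw [W_mk] at hq'
        simp only [wf, ne_eq, ite_eq_right_iff, Classical.not_imp] at hq'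
        obtain ⟨hc, hc0⟩ := hq'
        obtain ⟨m1, rfl⟩ := Multiset.exists_cons_of_mem hq
        have g1 : ∃ j : Fin n, (j : ℕ) < s ∧ (c j : ℕ) + 1 < r j := by
          have : ss s c < MM s r := by omega
          obtain ⟨j, hj, hlt⟩ := Finset.exists_lt_of_sum_lt this
          exact ⟨j, by simpa using hj, by omega⟩
        have g2 : ∃ j : Fin n, (j : ℕ) < s ∧ 0 < (b j : ℕ) := by
          have : ss s b ≠ 0 := by omega
          obtain ⟨j, hj, hlt⟩ := Finset.exists_ne_zero_of_sum_ne_zero this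
          exact ⟨j, by simpa using hj, by omega⟩
        obtain ⟨c', hc', b', hb', s1, s2, r1, r2, hI⟩ :=
          unit_step k hS hr z o hzo hzs hzt hos hfull c b hc hb g1 g2
        refine ih b' hb' _ (hrel.trans (Rel.pair b c b' c' m1
          (wf_unit b c b' c' hb hc hb' hc' (by omega) r2 r1) ?_)) ?_ (by omega)
        · rw [mul_comm (xvar k s b), mul_comm (xvar k s b')]
          exact hI
        intro i hi
        rw [r2 i hi, hba i hi]

lemma step (k : Type) [Field k] {s t : ℕ} {S : Set (Idx n r)} (hS : Good s t S)
    (hr : ∀ i, 2 ≤ r i)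
    (z o : Fin n) (hzo : z ≠ o) (hzs : (z : ℕ) < s) (hzt : (z : ℕ) < t) (hos : (o : ℕ) < s)
    (q : IQ n s r) (m m' : Multiset (IQ n s r))
    (hw : (m'.map (W hS)).sum = W hS q + (m.map (W hS)).sum) :
    ∃ m'', Rel k hS m' (q ::ₘ m'') := by
  induction q using Quotient.inductionOn with
  | h a =>
    by_cases ha : a ∈ S
    · obtain ⟨b, hb, m0, hrel, h1, h2⟩ := step1 k hS a ha m m' hw
        (Finset.univ.filter fun i : Fin n => s ≤ (i : ℕ) ∧ (i : ℕ) < t) (by simp)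
      have hba : ∀ i : Fin n, s ≤ (i : ℕ) → b i = a i := by
        intro i hi
        by_cases hit : (i : ℕ) < t
        · exact h1 i (by simp [hi, hit])
        · exact h2 i hi (by omega)
      rcases le_total (ss s b) (ss s a) with h | h
      · exact step2 k hS hr z o hzo hzs hzt hos a ha m m' hw (ss s a - ss s b) b hb m0 hrel hba
          (by omega)
      · exact step2 k hS hr z o hzo hzs hzt hos a ha m m' hw (ss s b - ss s a) b hb m0 hrel hba
          (by omega)
    · have h0 : (m'.map (W hS)).sum
          (Sum.inr (Sum.inr (Sum.inr (Quotient.mk (sSetoid n s r) a)))) ≠ 0 := by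
        rw [hw, Finsupp.add_apply, W_mk]
        simp [wf, ha]
      obtain ⟨q, hq, hq'⟩ := exists_of_sum_ne _ _ _ h0
      induction q using Quotient.inductionOn with
      | h b =>
        rw [W_mk] at hq'
        simp only [wf, ne_eq, ite_eq_right_iff, one_ne_zero, imp_false, not_not] at hq'
        rw [hq'.2] at hq
        obtain ⟨m0, rfl⟩ := Multiset.exists_cons_of_mem hq
        exact ⟨m0, Rel.refl k hS _⟩

lemma W_ne_zero {s t : ℕ} {S : Set (Idx n r)} (hS : Good s t S) (q : IQ n s r) :
    W hS q ≠ 0 := by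
  induction q using Quotient.inductionOn with
  | h a =>
    intro h
    by_cases ha : a ∈ S
    · have := DFunLike.congr_fun h
        (Sum.inr (Sum.inr (Sum.inl fun j => a j.1)) : Tau n s t r)
      rw [W_mk] at this
      simp [wf, ha] at this
    · have := DFunLike.congr_fun h
        (Sum.inr (Sum.inr (Sum.inr (Quotient.mk (sSetoid n s r) a))))
      rw [W_mk] at this
      simp [wf, ha] at this

lemma binom_mem (k : Type) [Field k] {s t : ℕ} {S : Set (Idx n r)} (hS : Good s t S)
    (hr : ∀ i, 2 ≤ r i)
    (z o : Fin n) (hzo : z ≠ o) (hzs : (z : ℕ) < s) (hzt : (z : ℕ) < t) (hos : (o : ℕ) < s)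
    (m : Multiset (IQ n s r)) : ∀ m' : Multiset (IQ n s r),
    (m.map (W hS)).sum = (m'.map (W hS)).sum →
    (m.map (X : IQ n s r → MvPolynomial (IQ n s r) k)).prod - (m'.map X).prod ∈ J k s t S := by
  induction m using Multiset.induction_on with
  | empty =>
    intro m' h
    induction m' using Multiset.induction_on with
    | empty => simp
    | cons q m' _ =>
      exfalso
      rw [Multiset.map_zero, Multiset.sum_zero, Multiset.map_cons, Multiset.sum_cons] at h
      apply W_ne_zero hS q
      ext x
      have := DFunLike.congr_fun h x
      rw [Finsupp.add_apply, Finsupp.zero_apply] at this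
      rw [Finsupp.zero_apply]
      omega
  | cons q m ih =>
    intro m' h
    rw [Multiset.map_cons, Multiset.sum_cons] at h
    obtain ⟨m'', hrel⟩ := step k hS hr z o hzo hzs hzt hos q m m' h.symm
    have e := h.trans hrel.1
    rw [Multiset.map_cons, Multiset.sum_cons] at e
    have h2 := ih m'' (add_left_cancel e)
    have h3 := hrel.2
    rw [Multiset.map_cons, Multiset.prod_cons] at h3 ⊢
    have h4 := sub_mem (Ideal.mul_mem_left (J k s t S) (X q) h2) h3
    convert h4 using 1
    ring

lemma J_prime (k : Type) [Field k] {s t : ℕ} {S : Set (Idx n r)} (hS : Good s t S)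
    (hr : ∀ i, 2 ≤ r i) (hs : 2 ≤ s) (hsn : s ≤ n) (ht1 : 1 ≤ t) : (J k s t S).IsPrime := by
  apply toric_prime (W hS)
  · rw [J, Ideal.span_le]
    rintro f ⟨i, a, b, hi, ha, hb, rfl⟩
    rw [SetLike.mem_coe, RingHom.mem_ker]
    simp only [gminor, xvar, map_sub, map_mul, aeval_X, monomial_mul, one_mul]
    rw [sub_eq_zero]
    congr 1
    apply congrArg
    refine Finsupp.ext fun x => ?_
    exact wf_sw hS i hi a b ha hb x
  · exact binom_mem k hS hr ⟨0, by omega⟩ ⟨1, by omega⟩ (by simp) (by simp; omega)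
      (by simp; omega) (by simp; omega)

end SwPrime

/-- for `s ≥ 2` and an `(s,t)`-switchable set `S` consisting of one
connectedness class, the ideal `Ĩ(s,t)_S` is prime; in particular `Ĩ(s,t)` is prime. -/
theorem ITildeS_isPrime (k : Type) [Field k] (n s t : ℕ) (r : Fin n → ℕ)
    (hr : ∀ i, 2 ≤ r i) (hs : 2 ≤ s) (hsn : s ≤ n) (ht1 : 1 ≤ t) (htn : t ≤ n)
    (S : Set (Idx n r)) (hSw : Switchable n s t r S)
    (hconn : ∀ a b, a ∈ S → b ∈ S → ConnectedIn S a b) :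
    (ITildeS k s t S).IsPrime ∧ (ITilde k s t r).IsPrime := by
  constructor
  · have h := SwPrime.J_prime k (SwPrime.good_of_switchable hSw hconn) hr hs hsn ht1
    have e : ITildeS k s t S = SwPrime.J k s t S := by
      unfold ITildeS SwPrime.J
      congr 1
      ext f
      constructor
      · rintro ⟨i, a, b, hi, ⟨K, c, rfl, rfl, hp⟩, rfl⟩
        exact ⟨i, _, _, hi, hp.1 _ (Nat.zero_le _), hp.1 _ le_rfl, rfl⟩
      · rintro ⟨i, a, b, hi, ha, hb, rfl⟩
        exact ⟨i, a, b, hi, hconn a b ha hb, rfl⟩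
    rw [e]; exact h
  · have h := SwPrime.J_prime (r := r) k (S := Set.univ)
      (⟨fun _ _ _ _ _ _ => trivial, fun _ _ _ _ => trivial⟩ : SwPrime.Good s t Set.univ)
      hr hs hsn ht1
    have e : ITilde k s t r = SwPrime.J k s t Set.univ := by
      unfold ITilde SwPrime.J
      congr 1
      ext f
      simp
    rw [e]; exact h
end

section
/- For n = 3 and s = 2, the ideal I(2,t) has exactly 2^{r_3} − 1 minimal primes: the prime Ĩ(2,t), and for each non-constant function φ : [r_3] → {(1,1), (r_1,r_2)} the monomial prime generated by the variables x_a with a ∉ S^φ, where S^φ = {a ∈ N : (a_1, a_2) = φ(a_3)}. -/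
open Finset

section Toric

/-- The full exchange relations. -/
def HY {A L : Type*} [CommRing A] (M : ℕ) (y : ℕ → L → A) : Prop :=
  ∀ m m' p p' l l', m ≤ M → m' ≤ M → p ≤ M → p' ≤ M → m + m' = p + p' →
    y m l * y m' l' = y p l * y p' l'

theorem hy_of_gen {A L : Type*} [CommRing A] (R0 R1 : ℕ) (h0 : 1 ≤ R0) (h1 : 1 ≤ R1)
    (y : ℕ → L → A)
    (hg : ∀ a0 b0 a1 b1 l l', a0 ≤ R0 → b0 ≤ R0 → a1 ≤ R1 → b1 ≤ R1 →
      y (a0 + a1) l * y (b0 + b1) l' = y (b0 + a1) l * y (a0 + b1) l') :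
    HY (R0 + R1) y := by
  have key : ∀ n m m' l l', (m - m') + (m' - m) ≤ n → m ≤ R0 + R1 → m' ≤ R0 + R1 →
      y m l * y m' l' = y ((m + m') / 2) l * y (m + m' - (m + m') / 2) l' := by
    intro n
    induction n with
    | zero =>
      intro m m' l l' hn hm hm'
      have e1 : (m + m') / 2 = m := by omega
      have e2 : m + m' - m = m' := by omega
      rw [e1, e2]
    | succ n ih =>
      intro m m' l l' hn hm hm'
      have close : ∀ m m', m + 2 ≤ m' → m' ≤ R0 + R1 → ∃ a0 b0 a1 b1, a0 ≤ R0 ∧ b0 ≤ R0 ∧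
          a1 ≤ R1 ∧ b1 ≤ R1 ∧ a0 < b0 ∧ a1 < b1 ∧ a0 + a1 = m ∧ b0 + b1 = m' := by
        intro m m' h2 hm'
        refine ⟨min m (R0 - 1), max (min m (R0 - 1) + 1) (m' - R1), m - min m (R0 - 1),
          m' - max (min m (R0 - 1) + 1) (m' - R1), ?_⟩
        omega
      rcases Nat.lt_or_ge (m + 1) m' with h | h
      · obtain ⟨a0, b0, a1, b1, ha0, hb0, ha1, hb1, h01, h11, e, e'⟩ := close m m' h hm'
        have := hg a0 b0 a1 b1 l l' ha0 hb0 ha1 hb1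
        rw [e, e'] at this
        rw [this, ih (b0 + a1) (a0 + b1) l l' (by omega) (by omega) (by omega)]
        have e3 : b0 + a1 + (a0 + b1) = m + m' := by omega
        rw [e3]
      · rcases Nat.lt_or_ge (m' + 1) m with h' | h'
        · obtain ⟨a0, b0, a1, b1, ha0, hb0, ha1, hb1, h01, h11, e, e'⟩ := close m' m h' hm
          have := hg b0 a0 b1 a1 l l' hb0 ha0 hb1 ha1
          rw [e, e'] at this
          rw [this, ih (a0 + b1) (b0 + a1) l l' (by omega) (by omega) (by omega)]
          have e3 : a0 + b1 + (b0 + a1) = m + m' := by omega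
          rw [e3]
        · by_cases hlt : m' < m
          · obtain rfl : m = m' + 1 := by omega
            have e1 : (m' + 1 + m') / 2 = m' := by omega
            have e2 : m' + 1 + m' - m' = m' + 1 := by omega
            rw [e1, e2]
            have := hg (min m' (R0 - 1) + 1) (min m' (R0 - 1)) (m' - min m' (R0 - 1))
              (m' - min m' (R0 - 1)) l l' (by omega) (by omega) (by omega) (by omega)
            have e3 : min m' (R0 - 1) + 1 + (m' - min m' (R0 - 1)) = m' + 1 := by omega
            have e4 : min m' (R0 - 1) + (m' - min m' (R0 - 1)) = m' := by omega
            rw [e3, e4] at this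
            exact this
          · have e1 : (m + m') / 2 = m := by omega
            have e2 : m + m' - m = m' := by omega
            rw [e1, e2]
  intro m m' p p' l l' hm hm' hp hp' hs
  rw [key _ m m' l l' le_rfl hm hm', key _ p p' l l' le_rfl hp hp', hs]

theorem sum_le_card {L : Type*} (M : ℕ) (v : Multiset (ℕ × L)) (hv : ∀ x ∈ v, x.1 ≤ M) :
    (v.map Prod.fst).sum ≤ v.card * M := by
  induction v using Multiset.induction with
  | empty => simp
  | cons a v ih =>
    have h1 := ih (fun x hx => hv x (Multiset.mem_cons_of_mem hx))
    have h2 := hv a (Multiset.mem_cons_self _ _)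
    simp only [Multiset.map_cons, Multiset.sum_cons, Multiset.card_cons]
    rw [Nat.add_mul]
    omega

theorem move {A L : Type*} [CommRing A] (M : ℕ) (y : ℕ → L → A) (hy : HY M y) (l : L) (m : ℕ)
    (hm : m ≤ M) (v : Multiset (ℕ × L)) :
    ∀ p, p ≤ M → (∀ x ∈ v, x.1 ≤ M) → m ≤ p + (v.map Prod.fst).sum →
      p + (v.map Prod.fst).sum ≤ m + v.card * M →
      ∃ v' : Multiset (ℕ × L), (∀ x ∈ v', x.1 ≤ M) ∧ v'.map Prod.snd = v.map Prod.snd ∧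
        m + (v'.map Prod.fst).sum = p + (v.map Prod.fst).sum ∧
        y m l * (v'.map (fun x => y x.1 x.2)).prod =
          y p l * (v.map (fun x => y x.1 x.2)).prod := by
  induction v using Multiset.induction with
  | empty =>
    intro p hp _ h1 h2
    simp at h1 h2
    obtain rfl : p = m := by omega
    exact ⟨0, by simp, rfl, rfl, rfl⟩
  | cons a v ih =>
    obtain ⟨q, l'⟩ := a
    intro p hp hv h1 h2
    have hq : q ≤ M := hv (q, l') (Multiset.mem_cons_self _ _)
    have hv' : ∀ x ∈ v, x.1 ≤ M := fun x hx => hv x (Multiset.mem_cons_of_mem hx)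
    have hs := sum_le_card M v hv'
    simp only [Multiset.map_cons, Multiset.sum_cons, Multiset.card_cons, Nat.add_mul] at h1 h2
    have step : ∀ p' q', p' ≤ M → q' ≤ M → p' + q' = p + q →
        (∃ v' : Multiset (ℕ × L), (∀ x ∈ v', x.1 ≤ M) ∧ v'.map Prod.snd = v.map Prod.snd ∧
        m + (v'.map Prod.fst).sum = p' + (v.map Prod.fst).sum ∧
        y m l * (v'.map (fun x => y x.1 x.2)).prod =
          y p' l * (v.map (fun x => y x.1 x.2)).prod) → 
        ∃ v' : Multiset (ℕ × L), (∀ x ∈ v', x.1 ≤ M) ∧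
          v'.map Prod.snd = ((q, l') ::ₘ v).map Prod.snd ∧
        m + (v'.map Prod.fst).sum = p + (((q, l') ::ₘ v).map Prod.fst).sum ∧
        y m l * (v'.map (fun x => y x.1 x.2)).prod =
          y p l * (((q, l') ::ₘ v).map (fun x => y x.1 x.2)).prod := by
      rintro p' q' hp' hq' hpq ⟨w, hw, hw2, hw3, hw4⟩
      refine ⟨(q', l') ::ₘ w, ?_, ?_, ?_, ?_⟩
      · intro x hx
        rcases Multiset.mem_cons.1 hx with rfl | hx
        · exact hq'
        · exact hw x hx
      · simp [hw2]
      · simp only [Multiset.map_cons, Multiset.sum_cons]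
        omega
      · simp only [Multiset.map_cons, Multiset.prod_cons]
        have := hy p q p' q' l l' hp hq hp' hq' hpq.symm
        calc _ = y q' l' * (y m l * (w.map (fun x => y x.1 x.2)).prod) := by ring
          _ = (y p' l * y q' l') * (v.map (fun x => y x.1 x.2)).prod := by rw [hw4]; ring
          _ = _ := by rw [← this]; ring
    by_cases c1 : p + q < m
    · exact step (p + q) 0 (by omega) (by omega) (by omega)
        (ih (p + q) (by omega) hv' (by omega) (by omega))
    · by_cases c2 : m + M < p + q
      · exact step (p + q - M) M (by omega) (by omega) (by omega)
          (ih (p + q - M) (by omega) hv' (by omega) (by omega))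
      · exact step m (p + q - m) (by omega) (by omega) (by omega)
          ⟨v, hv', rfl, rfl, rfl⟩

theorem toric {A L : Type*} [CommRing A] (M : ℕ) (y : ℕ → L → A) (hy : HY M y)
    (u : Multiset (ℕ × L)) : ∀ v : Multiset (ℕ × L), (∀ x ∈ u, x.1 ≤ M) → (∀ x ∈ v, x.1 ≤ M) →
    u.map Prod.snd = v.map Prod.snd → (u.map Prod.fst).sum = (v.map Prod.fst).sum →
    (u.map (fun x => y x.1 x.2)).prod = (v.map (fun x => y x.1 x.2)).prod := by
  induction u using Multiset.induction with
  | empty =>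
    intro v _ _ h _
    have : v = 0 := by simpa using h.symm
    rw [this]
  | cons a u ih =>
    obtain ⟨m, l⟩ := a
    intro v hu hv h1 h2
    have hl : l ∈ v.map Prod.snd := by rw [← h1]; simp
    obtain ⟨⟨p, l1⟩, hx, rfl⟩ := Multiset.mem_map.1 hl
    obtain ⟨w, rfl⟩ := Multiset.exists_cons_of_mem hx
    have hw : ∀ x ∈ w, x.1 ≤ M := fun x hx => hv x (Multiset.mem_cons_of_mem hx)
    have hu' : ∀ x ∈ u, x.1 ≤ M := fun x hx => hu x (Multiset.mem_cons_of_mem hx)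
    have hm : m ≤ M := hu _ (Multiset.mem_cons_self _ _)
    have hp : p ≤ M := hv _ (Multiset.mem_cons_self _ _)
    simp only [Multiset.map_cons, Multiset.sum_cons, Multiset.cons_inj_right] at h1 h2
    have hc : u.card = w.card := by simpa using congrArg Multiset.card h1
    have hs := sum_le_card M u hu'
    obtain ⟨v', a1, a2, a3, a4⟩ := move M y hy l1 m hm w p hp hw (by omega)
      (by rw [← hc]; omega)
    simp only [Multiset.map_cons, Multiset.prod_cons]
    rw [← a4, ih v' hu' a1 (h1.trans a2.symm) (by omega)]

theorem field_cases {F L : Type*} [Field F] (M R0 R1 : ℕ) (hM : M = R0 + R1) (h0 : 1 ≤ R0) (h1 : 1 ≤ R1)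
    (y : ℕ → L → F)
    (H1 : ∀ m l, m + 2 ≤ M → y m l * y (m + 2) l = y (m + 1) l * y (m + 1) l)
    (H2 : ∀ l, y 0 l * y M l = y R0 l * y R1 l)
    (C : ∀ m l l', m + 1 ≤ M → y m l * y (m + 1) l' = y (m + 1) l * y m l') :
    HY (M) y ∨ ∃ φ : L → Bool, (∃ l l', φ l ≠ φ l') ∧
      ∀ m l, m ≤ M → (φ l = true → m ≠ M → y m l = 0) ∧
        (φ l = false → m ≠ 0 → y m l = 0) := by
  classical
  have hM2 : 2 ≤ M := by omega
  have hR0 : R0 < M := by omega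
  have hR1 : R1 < M := by omega
  by_cases hfull : ∃ l, y 1 l ≠ 0
  · left
    obtain ⟨l0, hl0⟩ := hfull
    have g0 : y 0 l0 ≠ 0 := by
      intro h
      have := H1 0 l0 (by omega)
      rw [h, zero_mul] at this
      exact hl0 (by simpa using this.symm)
    have gn : ∀ m, m + 1 ≤ M → y m l0 ≠ 0 ∧ y (m + 1) l0 ≠ 0 := by
      intro m
      induction m with
      | zero => intro _; exact ⟨g0, hl0⟩
      | succ m ih =>
        intro hm
        obtain ⟨i1, i2⟩ := ih (by omega)
        refine ⟨i2, fun h => ?_⟩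
        have := H1 m l0 (by omega)
        rw [h, mul_zero] at this
        exact i2 (by simpa using this.symm)
    have gr : ∀ m, m + 1 ≤ M → y (m + 1) l0 = y m l0 * (y 1 l0 / y 0 l0) := by
      intro m
      induction m with
      | zero => intro _; field_simp
      | succ m ih =>
        intro hm
        have e := H1 m l0 (by omega)
        have i := ih (by omega)
        have n := (gn m (by omega)).1
        apply mul_left_cancel₀ n
        rw [e]
        conv_lhs => rw [i]
        rw [i]; ring
    have yr : ∀ m l, m ≤ M → y m l = y 0 l * (y 1 l0 / y 0 l0) ^ m := by
      intro m l
      induction m with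
      | zero => intro _; simp
      | succ m ih =>
        intro hm
        have i := ih (by omega)
        have c := C m l l0 (by omega)
        rw [gr m hm] at c
        have n := (gn m (by omega)).1
        apply mul_right_cancel₀ n
        rw [← c, i]; ring
    intro m m' p p' l l' hm hm' hp hp' hs
    rw [yr m l hm, yr m' l' hm', yr p l hp, yr p' l' hp']
    calc _ = y 0 l * y 0 l' * (y 1 l0 / y 0 l0) ^ (m + m') := by ring
      _ = _ := by rw [hs]; ring
  · push Not at hfull
    have int0 : ∀ m l, m + 2 ≤ M → y (m + 1) l = 0 := by
      intro m l
      induction m with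
      | zero => intro _; exact hfull l
      | succ m ih =>
        intro hm
        have := H1 (m + 1) l (by omega)
        rw [ih (by omega), zero_mul] at this
        simpa using this.symm
    have int : ∀ m l, m ≠ 0 → m < M → y m l = 0 := by
      intro m l hm hm'
      obtain ⟨m, rfl⟩ := Nat.exists_eq_succ_of_ne_zero hm
      exact int0 m l (by omega)
    have ends : ∀ l, y M l ≠ 0 → y 0 l = 0 := by
      intro l hl
      have := H2 l
      rw [int R0 l (by omega) hR0, zero_mul] at this
      exact (mul_eq_zero.1 this).resolve_right hl
    by_cases hA : ∀ l, y M l = 0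
    · left
      have z : ∀ m l, m ≤ M → m ≠ 0 → y m l = 0 := by
        intro m l h h'
        rcases h.lt_or_eq with h | rfl
        · exact int m l h' h
        · exact hA l
      intro m m' p p' l l' hm hm' hp hp' hs
      by_cases c : m = 0 ∧ m' = 0
      · obtain ⟨rfl, rfl⟩ := c
        obtain rfl : p = 0 := by omega
        obtain rfl : p' = 0 := by omega
        rfl
      · have e1 : y m l * y m' l' = 0 := by
          by_cases c1 : m = 0
          · rw [z m' l' hm' (by omega), mul_zero]
          · rw [z m l hm c1, zero_mul]
        have e2 : y p l * y p' l' = 0 := by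
          by_cases c1 : p = 0
          · rw [z p' l' hp' (by omega), mul_zero]
          · rw [z p l hp c1, zero_mul]
        rw [e1, e2]
    · by_cases hB : ∀ l, y M l ≠ 0
      · left
        have z : ∀ m l, m ≤ M → m ≠ M → y m l = 0 := by
          intro m l h h'
          by_cases h0 : m = 0
          · rw [h0]; exact ends l (hB l)
          · exact int m l h0 (by omega)
        intro m m' p p' l l' hm hm' hp hp' hs
        by_cases c : m = M ∧ m' = M
        · obtain ⟨e1, e2⟩ := c
          obtain e3 : p = M := by omega
          obtain e4 : p' = M := by omega
          rw [e1, e2, e3, e4]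
        · have e1 : y m l * y m' l' = 0 := by
            by_cases c1 : m = M
            · rw [z m' l' hm' (by omega), mul_zero]
            · rw [z m l hm c1, zero_mul]
          have e2 : y p l * y p' l' = 0 := by
            by_cases c1 : p = M
            · rw [z p' l' hp' (by omega), mul_zero]
            · rw [z p l hp c1, zero_mul]
          rw [e1, e2]
      · right
        push Not at hA hB
        obtain ⟨l, hl⟩ := hA
        obtain ⟨l', hl'⟩ := hB
        refine ⟨fun l => decide (y M l ≠ 0), ⟨l, l', by simp [hl, hl']⟩, ?_⟩
        intro m l hm
        refine ⟨fun h hne => ?_, fun h hne => ?_⟩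
        · have h : y M l ≠ 0 := by simpa using h
          by_cases h0 : m = 0
          · rw [h0]; exact ends l h
          · exact int m l h0 (by omega)
        · have h : y M l = 0 := by simpa using h
          rcases hm.lt_or_eq with h' | rfl
          · exact int m l hne h'
          · exact h

end Toric

section Ring

variable {r : Fin 3 → ℕ}

/-- An index built from three entries. -/
def mkIdx (x : Fin (r 0)) (y : Fin (r 1)) (z : Fin (r 2)) : Idx 3 r := fun i =>
  match i with
  | 0 => x
  | 1 => y
  | 2 => z

/-- A representative of the class `(m, l)`. -/
def rep (hr : ∀ i, 2 ≤ r i) (m : ℕ) (l : Fin (r 2)) : Idx 3 r :=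
  mkIdx ⟨min m (r 0 - 1), by have := hr 0; omega⟩
    ⟨min (m - (r 0 - 1)) (r 1 - 1), by have := hr 1; omega⟩ l

theorem sEquiv_iff (a b : Idx 3 r) :
    sEquiv 3 2 r a b ↔ (a 0 : ℕ) + a 1 = (b 0 : ℕ) + b 1 ∧ a 2 = b 2 := by
  unfold sEquiv
  simp [Finset.sum_filter, Fin.sum_univ_three, Fin.forall_fin_succ]

/-- The variable of class `(m, l)`. -/
noncomputable def Yv (k : Type) [CommRing k] (hr : ∀ i, 2 ≤ r i) (m : ℕ) (l : Fin (r 2)) :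
    MvPolynomial (IQ 3 2 r) k := xvar k 2 (rep hr m l)

theorem mk_eq_rep (hr : ∀ i, 2 ≤ r i) (a : Idx 3 r) :
    (Quotient.mk (sSetoid 3 2 r) a) =
      Quotient.mk (sSetoid 3 2 r) (rep hr ((a 0 : ℕ) + a 1) (a 2)) := by
  apply Quotient.sound
  change sEquiv 3 2 r _ _
  rw [sEquiv_iff]
  have h0 := (a 0).2
  have h1 := (a 1).2
  simp only [rep, mkIdx]
  constructor
  · omega
  · trivial

theorem xvar_eq (k : Type) [CommRing k] (hr : ∀ i, 2 ≤ r i) (a : Idx 3 r) :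
    xvar k 2 a = Yv k hr ((a 0 : ℕ) + a 1) (a 2) := by
  unfold Yv xvar
  rw [mk_eq_rep hr a]

theorem xvar_mkIdx (k : Type) [CommRing k] (hr : ∀ i, 2 ≤ r i) (x : Fin (r 0)) (y : Fin (r 1))
    (z : Fin (r 2)) :
    xvar k 2 (mkIdx x y z) = Yv k hr ((x : ℕ) + y) z := xvar_eq k hr _

theorem tilde_le (k : Type) [CommRing k] (t : ℕ) (hr : ∀ i, 2 ≤ r i) {A : Type*} [CommRing A]
    (f : MvPolynomial (IQ 3 2 r) k →+* A)
    (hy : HY (r 0 - 1 + (r 1 - 1)) (fun m l => f (Yv k hr m l))) :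
    ITilde k 2 t r ≤ RingHom.ker f := by
  unfold ITilde
  rw [Ideal.span_le]
  rintro _ ⟨i, a, b, hi, rfl⟩
  rw [SetLike.mem_coe, RingHom.mem_ker]
  unfold gminor
  rw [map_sub, map_mul, map_mul, sub_eq_zero]
  simp only [xvar_eq k hr]
  have ha0 := (a 0).2
  have ha1 := (a 1).2
  have hb0 := (b 0).2
  have hb1 := (b 1).2
  fin_cases i
  · simp only [sw]
    exact hy _ _ _ _ _ _ (by omega) (by omega) (by simp; omega) (by simp; omega)
      (by simp; omega)
  · simp only [sw]
    exact hy _ _ _ _ _ _ (by omega) (by omega) (by simp; omega) (by simp; omega)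
      (by simp; omega)
  · have h := hy (a 0 + a 1) (b 0 + b 1) (b 0 + b 1) (a 0 + a 1) (a 2) (b 2)
      (by omega) (by omega) (by omega) (by omega) (by omega)
    refine h.trans ?_
    rw [mul_comm]
    rfl

theorem hy_tilde (k : Type) [CommRing k] (t : ℕ) (ht : 1 ≤ t) (hr : ∀ i, 2 ≤ r i) :
    HY (r 0 - 1 + (r 1 - 1))
      (fun m l => Ideal.Quotient.mk (ITilde k 2 t r) (Yv k hr m l)) := by
  have h0 := hr 0
  have h1 := hr 1
  apply hy_of_gen _ _ (by omega) (by omega)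
  intro a0 b0 a1 b1 l l' ha0 hb0 ha1 hb1
  rw [← map_mul, ← map_mul, Ideal.Quotient.eq]
  apply Ideal.subset_span
  refine ⟨0, mkIdx ⟨a0, by omega⟩ ⟨a1, by omega⟩ l, mkIdx ⟨b0, by omega⟩ ⟨b1, by omega⟩ l',
    ht, ?_⟩
  unfold gminor
  simp only [xvar_eq k hr]
  rfl

theorem slice_mem (k : Type) [CommRing k] (t : ℕ) (ht : 1 ≤ t) (hr : ∀ i, 2 ≤ r i)
    (a0 b0 a1 b1 : ℕ) (l l' : Fin (r 2))
    (ha0 : a0 < r 0) (hb0 : b0 < r 0) (ha1 : a1 < r 1) (hb1 : b1 < r 1) (hne : a0 ≠ b0)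
    (h : (a1 ≠ b1 ∧ l = l') ∨ (a1 = b1 ∧ l ≠ l')) :
    Yv k hr (a0 + a1) l * Yv k hr (b0 + b1) l' - Yv k hr (b0 + a1) l * Yv k hr (a0 + b1) l' ∈
      ISlice k 2 t r := by
  apply Ideal.subset_span
  refine ⟨0, mkIdx ⟨a0, by omega⟩ ⟨a1, by omega⟩ l, mkIdx ⟨b0, by omega⟩ ⟨b1, by omega⟩ l',
    ht, ?_, ?_⟩
  · unfold hammingDist
    rw [Finset.card_filter, Fin.sum_univ_three]
    simp only [mkIdx, ne_eq, Fin.mk.injEq]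
    rcases h with ⟨h, h'⟩ | ⟨h, h'⟩ <;> simp [hne, h, h']
  · unfold gminor
    simp only [xvar_eq k hr]
    rfl

/-- Exponent vector of the toric parametrization. -/
noncomputable def Ex {L : Type*} (x : ℕ × L) : Option L →₀ ℕ :=
  Finsupp.single (some x.2) 1 + Finsupp.single none x.1

theorem Ex_none {L : Type*} (w : Multiset (ℕ × L)) :
    (w.map Ex).sum none = (w.map Prod.fst).sum := by
  induction w using Multiset.induction with
  | empty => simp
  | cons a w ih => simp [ih, Ex]

theorem Ex_some {L : Type*} [DecidableEq L] (w : Multiset (ℕ × L)) (l : L) :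
    (w.map Ex).sum (some l) = (w.map Prod.snd).count l := by
  induction w using Multiset.induction with
  | empty => simp
  | cons a w ih =>
    simp [ih, Ex, Multiset.count_cons, Finsupp.single_apply, add_comm, eq_comm]

/-- The class `(m, l)` of a variable. -/
def dg (q : IQ 3 2 r) : ℕ × Fin (r 2) :=
  Quotient.lift (fun a : Idx 3 r => ((a 0 : ℕ) + a 1, a 2)) (by
    intro a b h
    have := (sEquiv_iff a b).1 h
    exact Prod.ext this.1 this.2) q

theorem dg_le (q : IQ 3 2 r) : (dg q).1 ≤ r 0 - 1 + (r 1 - 1) := by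
  induction q using Quotient.inductionOn with
  | h a =>
    have h0 := (a 0).2
    have h1 := (a 1).2
    change (a 0 : ℕ) + a 1 ≤ _
    omega

theorem X_eq_Yv (k : Type) [CommRing k] (hr : ∀ i, 2 ≤ r i) (q : IQ 3 2 r) :
    (MvPolynomial.X q : MvPolynomial (IQ 3 2 r) k) = Yv k hr (dg q).1 (dg q).2 := by
  induction q using Quotient.inductionOn with
  | h a => exact xvar_eq k hr a

theorem dg_rep (hr : ∀ i, 2 ≤ r i) (m : ℕ) (l : Fin (r 2)) (hm : m ≤ r 0 - 1 + (r 1 - 1)) :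
    dg (Quotient.mk (sSetoid 3 2 r) (rep hr m l)) = (m, l) := by
  change (min m (r 0 - 1) + min (m - (r 0 - 1)) (r 1 - 1), l) = (m, l)
  congr 1
  omega

/-- The toric parametrization. -/
noncomputable def tor (k : Type) [CommRing k] (r : Fin 3 → ℕ) :
    MvPolynomial (IQ 3 2 r) k →ₐ[k] MvPolynomial (Option (Fin (r 2))) k :=
  MvPolynomial.aeval (fun q => MvPolynomial.monomial (Ex (dg q)) 1)

theorem monomial_prod (k : Type) [CommRing k] {A : Type*} [CommRing A]
    [Algebra k A] (f : MvPolynomial (IQ 3 2 r) k →ₐ[k] A) (u : IQ 3 2 r →₀ ℕ) :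
    f (MvPolynomial.monomial u 1) =
      ((Finsupp.toMultiset u).map (fun q => f (MvPolynomial.X q))).prod := by
  induction u using Finsupp.induction_linear with
  | zero => simp
  | add u v hu hv =>
    rw [← one_mul (1 : k), ← MvPolynomial.monomial_mul, map_mul, hu, hv]
    simp
  | single a n =>
    rw [← MvPolynomial.X_pow_eq_monomial, map_pow]
    simp [Multiset.map_nsmul, Multiset.prod_nsmul]

theorem prod_monomial {k τ : Type*} [CommRing k] {ι : Type*} (w : Multiset ι) (e : ι → τ →₀ ℕ) :
    (w.map (fun i => (MvPolynomial.monomial (e i) (1 : k)))).prod =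
      MvPolynomial.monomial (w.map e).sum 1 := by
  induction w using Multiset.induction with
  | empty => simp
  | cons a w ih => simp [ih, MvPolynomial.monomial_mul]

theorem tor_monomial (k : Type) [CommRing k] (u : IQ 3 2 r →₀ ℕ) :
    tor k r (MvPolynomial.monomial u 1) =
      MvPolynomial.monomial ((((Finsupp.toMultiset u).map dg).map Ex).sum) 1 := by
  rw [monomial_prod, Multiset.map_map, ← prod_monomial]
  simp [tor]

theorem ker_tor_le (k : Type) [Field k] (t : ℕ) (ht : 1 ≤ t) (hr : ∀ i, 2 ≤ r i) :
    RingHom.ker (tor k r) ≤ ITilde k 2 t r := by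
  classical
  have hy := hy_tilde k t ht hr
  let e : (IQ 3 2 r →₀ ℕ) → (Option (Fin (r 2)) →₀ ℕ) := fun u =>
    (((Finsupp.toMultiset u).map dg).map Ex).sum
  have key : ∀ u v, e u = e v →
      Ideal.Quotient.mkₐ k (ITilde k 2 t r) (MvPolynomial.monomial u 1) =
      Ideal.Quotient.mkₐ k (ITilde k 2 t r) (MvPolynomial.monomial v 1) := by
    intro u v huv
    have := toric _ _ hy ((Finsupp.toMultiset u).map dg) ((Finsupp.toMultiset v).map dg)
      (by simp only [Multiset.mem_map]; rintro _ ⟨q, _, rfl⟩; exact dg_le q)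
      (by simp only [Multiset.mem_map]; rintro _ ⟨q, _, rfl⟩; exact dg_le q)
      (by
        ext l
        rw [← Ex_some, ← Ex_some]
        exact DFunLike.congr_fun huv (some l))
      (by
        rw [← Ex_none, ← Ex_none]
        exact DFunLike.congr_fun huv none)
    rw [monomial_prod, monomial_prod]
    simp only [Multiset.map_map, Function.comp_def] at this
    simp only [X_eq_Yv k hr]
    exact this
  let NF : (Option (Fin (r 2)) →₀ ℕ) → (MvPolynomial (IQ 3 2 r) k ⧸ ITilde k 2 t r) := fun d =>
    if h : ∃ u, e u = d then
      Ideal.Quotient.mkₐ k (ITilde k 2 t r) (MvPolynomial.monomial h.choose 1) else 0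
  let σ := (MvPolynomial.basisMonomials (Option (Fin (r 2))) k).constr k NF
  have hσ : σ ∘ₗ (tor k r).toLinearMap =
      (Ideal.Quotient.mkₐ k (ITilde k 2 t r)).toLinearMap := by
    apply (MvPolynomial.basisMonomials (IQ 3 2 r) k).ext
    intro u
    simp only [MvPolynomial.coe_basisMonomials, LinearMap.comp_apply, AlgHom.toLinearMap_apply]
    rw [tor_monomial]
    have : σ (MvPolynomial.monomial (e u) 1) = NF (e u) := by
      have := (MvPolynomial.basisMonomials (Option (Fin (r 2))) k).constr_basis k NF (e u)
      simpa using this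
    refine this.trans ?_
    have hex : ∃ v, e v = e u := ⟨u, rfl⟩
    simp only [NF, dif_pos hex]
    exact key _ _ hex.choose_spec
  intro f hf
  have hf : tor k r f = 0 := hf
  have := LinearMap.congr_fun hσ f
  simp only [LinearMap.comp_apply, AlgHom.toLinearMap_apply, hf, map_zero] at this
  exact Ideal.Quotient.eq_zero_iff_mem.1 this.symm

theorem tor_Yv (k : Type) [CommRing k] (hr : ∀ i, 2 ≤ r i) (m : ℕ) (l : Fin (r 2))
    (hm : m ≤ r 0 - 1 + (r 1 - 1)) :
    tor k r (Yv k hr m l) = MvPolynomial.monomial (Ex (m, l)) 1 := by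
  unfold Yv xvar tor
  rw [MvPolynomial.aeval_X, dg_rep hr m l hm]

theorem tilde_eq (k : Type) [Field k] (t : ℕ) (ht : 1 ≤ t) (hr : ∀ i, 2 ≤ r i) :
    ITilde k 2 t r = RingHom.ker (tor k r) := by
  apply le_antisymm _ (ker_tor_le k t ht hr)
  apply tilde_le k t hr (tor k r).toRingHom
  intro m m' p p' l l' hm hm' hp hp' hs
  change tor k r _ * tor k r _ = tor k r _ * tor k r _
  rw [tor_Yv k hr _ _ hm, tor_Yv k hr _ _ hm', tor_Yv k hr _ _ hp, tor_Yv k hr _ _ hp']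
  simp only [MvPolynomial.monomial_mul, Ex]
  congr 1
  have := congrArg (Finsupp.single (none : Option (Fin (r 2)))) hs
  rw [Finsupp.single_add, Finsupp.single_add] at this
  rw [add_add_add_comm, this, add_add_add_comm]

end Ring

section Mono

open Classical in
/-- Killing the variables in `s`. -/
noncomputable def kill (k : Type) [Field k] {τ : Type*} (s : Set τ) :
    MvPolynomial τ k →ₐ[k] MvPolynomial τ k :=
  MvPolynomial.aeval (fun q => if q ∈ s then 0 else MvPolynomial.X q)

theorem ker_kill (k : Type) [Field k] {τ : Type*} (s : Set τ) :
    RingHom.ker (kill k s) = Ideal.span (MvPolynomial.X '' s) := by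
  classical
  apply le_antisymm
  · have h : (Ideal.Quotient.mkₐ k (Ideal.span (MvPolynomial.X '' s : Set (MvPolynomial τ k)))).comp
        (kill k s) = Ideal.Quotient.mkₐ k _ := by
      apply MvPolynomial.algHom_ext
      intro q
      rw [AlgHom.comp_apply, kill, MvPolynomial.aeval_X]
      by_cases hq : q ∈ s
      · rw [if_pos hq, map_zero]
        symm
        exact Ideal.Quotient.eq_zero_iff_mem.2 (Ideal.subset_span ⟨q, hq, rfl⟩)
      · rw [if_neg hq]
    intro f hf
    have hf : kill k s f = 0 := hf
    have := DFunLike.congr_fun h f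
    rw [AlgHom.comp_apply, hf, map_zero] at this
    exact Ideal.Quotient.eq_zero_iff_mem.1 this.symm
  · rw [Ideal.span_le]
    rintro _ ⟨q, hq, rfl⟩
    rw [SetLike.mem_coe, RingHom.mem_ker, kill, MvPolynomial.aeval_X, if_pos hq]

theorem span_X_prime (k : Type) [Field k] {τ : Type*} (s : Set τ) :
    (Ideal.span (MvPolynomial.X '' s : Set (MvPolynomial τ k))).IsPrime := by
  rw [← ker_kill]
  exact RingHom.ker_isPrime _

theorem X_mem_span (k : Type) [Field k] {τ : Type*} (s : Set τ) (q : τ) :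
    (MvPolynomial.X q : MvPolynomial τ k) ∈ Ideal.span (MvPolynomial.X '' s) ↔ q ∈ s := by
  classical
  refine ⟨fun h => ?_, fun h => Ideal.subset_span ⟨q, h, rfl⟩⟩
  rw [← ker_kill, RingHom.mem_ker, kill, MvPolynomial.aeval_X] at h
  by_contra hq
  rw [if_neg hq] at h
  exact MvPolynomial.X_ne_zero q h

variable {r : Fin 3 → ℕ}

/-- The set `S^φ`. -/
def Sphi (φ : Fin (r 2) → Bool) : Set (Idx 3 r) :=
  {x : Idx 3 r |
    (φ (x 2) = true → (x 0 : ℕ) = r 0 - 1 ∧ (x 1 : ℕ) = r 1 - 1) ∧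
    (φ (x 2) = false → (x 0 : ℕ) = 0 ∧ (x 1 : ℕ) = 0)}

/-- The monomial prime of `φ`. -/
noncomputable def Pphi (k : Type) [Field k] (φ : Fin (r 2) → Bool) :
    Ideal (MvPolynomial (IQ 3 2 r) k) :=
  Ideal.span {f | ∃ a : Idx 3 r, a ∉ Sphi φ ∧
    f = MvPolynomial.X (Quotient.mk (sSetoid 3 2 r) a)}

theorem mem_Sphi_iff (φ : Fin (r 2) → Bool) (a : Idx 3 r) :
    a ∈ Sphi φ ↔ (φ (a 2) = true → (a 0 : ℕ) + a 1 = r 0 - 1 + (r 1 - 1)) ∧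
      (φ (a 2) = false → (a 0 : ℕ) + a 1 = 0) := by
  have h0 := (a 0).2
  have h1 := (a 1).2
  unfold Sphi
  rw [Set.mem_ofPred_eq]
  refine and_congr (imp_congr_right fun _ => ?_) (imp_congr_right fun _ => ?_) <;> omega

theorem Pphi_eq (k : Type) [Field k] (φ : Fin (r 2) → Bool) :
    Pphi k φ = Ideal.span (MvPolynomial.X '' (Quotient.mk (sSetoid 3 2 r) '' (Sphi φ)ᶜ)) := by
  unfold Pphi
  congr 1
  ext f
  constructor
  · rintro ⟨a, ha, rfl⟩
    exact ⟨_, ⟨a, ha, rfl⟩, rfl⟩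
  · rintro ⟨_, ⟨a, ha, rfl⟩, rfl⟩
    exact ⟨a, ha, rfl⟩

theorem X_mem_Pphi (k : Type) [Field k] (φ : Fin (r 2) → Bool) (a : Idx 3 r) :
    xvar k 2 a ∈ Pphi k φ ↔ a ∉ Sphi φ := by
  rw [Pphi_eq, xvar, X_mem_span]
  constructor
  · rintro ⟨b, hb, hab⟩ ha
    have := (sEquiv_iff b a).1 (Quotient.exact hab)
    apply hb
    rw [mem_Sphi_iff] at ha ⊢
    rw [this.1, this.2]
    exact ha
  · intro h
    exact ⟨a, h, rfl⟩

theorem Yv_mem_Pphi (k : Type) [Field k] (hr : ∀ i, 2 ≤ r i) (φ : Fin (r 2) → Bool) (m : ℕ)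
    (l : Fin (r 2)) (hm : m ≤ r 0 - 1 + (r 1 - 1)) :
    Yv k hr m l ∉ Pphi k φ ↔
      (φ l = true → m = r 0 - 1 + (r 1 - 1)) ∧ (φ l = false → m = 0) := by
  rw [Yv, X_mem_Pphi, not_not, mem_Sphi_iff]
  have := dg_rep hr m l hm
  have h1 : (rep hr m l 0 : ℕ) + rep hr m l 1 = m := congrArg Prod.fst this
  have h2 : rep hr m l 2 = l := rfl
  rw [h1, h2]

theorem Pphi_prime (k : Type) [Field k] (φ : Fin (r 2) → Bool) : (Pphi k φ).IsPrime := by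
  rw [Pphi_eq]
  exact span_X_prime k _

theorem not_both (φ : Fin (r 2) → Bool) (hr : ∀ i, 2 ≤ r i) (a b : Idx 3 r)
    (h : hammingDist a b = 2) : a ∉ Sphi φ ∨ b ∉ Sphi φ := by
  by_contra hc
  push Not at hc
  obtain ⟨ha, hb⟩ := hc
  have h0 := hr 0
  have h1 := hr 1
  unfold hammingDist at h
  rw [Finset.card_filter, Fin.sum_univ_three] at h
  simp only [Sphi, Set.mem_ofPred_eq] at ha hb
  simp only [ne_eq, Fin.ext_iff] at h
  cases h2 : φ (a 2) <;> cases h3 : φ (b 2) <;> simp only [h2, h3, true_implies,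
    Bool.false_eq_true, Bool.true_eq_false, false_implies, and_true, true_and] at ha hb
  · rw [if_neg (by omega), if_neg (by omega)] at h
    split_ifs at h <;> omega
  · have : ¬ ((a 2 : ℕ) = b 2) := by
      intro e
      rw [Fin.ext e, h3] at h2
      cases h2
    rw [if_pos (by omega), if_pos (by omega), if_pos this] at h
    omega
  · have : ¬ ((a 2 : ℕ) = b 2) := by
      intro e
      rw [Fin.ext e, h3] at h2
      cases h2
    rw [if_pos (by omega), if_pos (by omega), if_pos this] at h
    omega
  · rw [if_neg (by omega), if_neg (by omega)] at h
    split_ifs at h <;> omega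

theorem hamming_sw (i : Fin 3) (a b : Idx 3 r) :
    hammingDist (sw i a b) (sw i b a) = hammingDist a b := by
  unfold hammingDist
  congr 1
  ext j
  rw [Finset.mem_filter, Finset.mem_filter]
  simp only [sw]
  split_ifs <;> simp [eq_comm]

theorem slice_le_Pphi (k : Type) [Field k] (t : ℕ) (hr : ∀ i, 2 ≤ r i) (φ : Fin (r 2) → Bool) :
    ISlice k 2 t r ≤ Pphi k φ := by
  unfold ISlice
  rw [Ideal.span_le]
  have key : ∀ a b : Idx 3 r, hammingDist a b = 2 → xvar k 2 a * xvar k 2 b ∈ Pphi k φ := by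
    intro a b h
    rcases not_both φ hr a b h with h | h
    · exact Ideal.mul_mem_right _ _ ((X_mem_Pphi k φ a).2 h)
    · exact Ideal.mul_mem_left _ _ ((X_mem_Pphi k φ b).2 h)
  rintro _ ⟨i, a, b, hi, hd, rfl⟩
  exact Ideal.sub_mem _ (key a b hd) (key _ _ ((hamming_sw i a b).trans hd))

theorem prime_cases (k : Type) [Field k] (t : ℕ) (ht : 1 ≤ t) (hr : ∀ i, 2 ≤ r i)
    (P : Ideal (MvPolynomial (IQ 3 2 r) k)) [P.IsPrime] (hP : ISlice k 2 t r ≤ P) :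
    ITilde k 2 t r ≤ P ∨ ∃ φ : Fin (r 2) → Bool, (∃ l l', φ l ≠ φ l') ∧ Pphi k φ ≤ P := by
  have h0 := hr 0
  have h1 := hr 1
  let f := algebraMap (MvPolynomial (IQ 3 2 r) k) P.ResidueField
  have hf : ∀ x, f x = 0 ↔ x ∈ P := fun x => Ideal.algebraMap_residueField_eq_zero
  have rel : ∀ a0 b0 a1 b1 l l', a0 < r 0 → b0 < r 0 → a1 < r 1 → b1 < r 1 → a0 ≠ b0 →
      ((a1 ≠ b1 ∧ l = l') ∨ (a1 = b1 ∧ l ≠ l')) →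
      f (Yv k hr (a0 + a1) l) * f (Yv k hr (b0 + b1) l') =
        f (Yv k hr (b0 + a1) l) * f (Yv k hr (a0 + b1) l') := by
    intro a0 b0 a1 b1 l l' ha0 hb0 ha1 hb1 hne h
    rw [← map_mul, ← map_mul, ← sub_eq_zero, ← map_sub, hf]
    exact hP (slice_mem k t ht hr a0 b0 a1 b1 l l' ha0 hb0 ha1 hb1 hne h)
  have fc := field_cases (r 0 - 1 + (r 1 - 1)) (r 0 - 1) (r 1 - 1) rfl (by omega) (by omega)
    (fun m l => f (Yv k hr m l))
  specialize fc ?_ ?_ ?_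
  · intro m l hm
    have := rel (min m (r 0 - 2)) (min m (r 0 - 2) + 1) (m - min m (r 0 - 2))
      (m - min m (r 0 - 2) + 1) l l (by omega) (by omega) (by omega) (by omega) (by omega)
      (Or.inl ⟨by omega, rfl⟩)
    have e1 : min m (r 0 - 2) + (m - min m (r 0 - 2)) = m := by omega
    have e2 : min m (r 0 - 2) + 1 + (m - min m (r 0 - 2) + 1) = m + 2 := by omega
    have e3 : min m (r 0 - 2) + 1 + (m - min m (r 0 - 2)) = m + 1 := by omega
    have e4 : min m (r 0 - 2) + (m - min m (r 0 - 2) + 1) = m + 1 := by omega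
    rw [e1, e2, e3, e4] at this
    exact this
  · intro l
    have := rel 0 (r 0 - 1) 0 (r 1 - 1) l l (by omega) (by omega) (by omega) (by omega) (by omega)
      (Or.inl ⟨by omega, rfl⟩)
    simpa using this
  · intro m l l' hm
    by_cases hl : l = l'
    · rw [hl]; exact mul_comm _ _
    have := rel (min m (r 0 - 2)) (min m (r 0 - 2) + 1) (m - min m (r 0 - 2))
      (m - min m (r 0 - 2)) l l' (by omega) (by omega) (by omega) (by omega) (by omega)
      (Or.inr ⟨rfl, hl⟩)
    have e1 : min m (r 0 - 2) + (m - min m (r 0 - 2)) = m := by omega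
    have e3 : min m (r 0 - 2) + 1 + (m - min m (r 0 - 2)) = m + 1 := by omega
    rw [e1, e3] at this
    exact this
  rcases fc with h | ⟨φ, hφ, h⟩
  · left
    intro x hx
    exact (hf x).1 (tilde_le k t hr f h hx)
  · right
    refine ⟨φ, hφ, ?_⟩
    unfold Pphi
    rw [Ideal.span_le]
    rintro _ ⟨a, ha, rfl⟩
    have ha0 := (a 0).2
    have ha1 := (a 1).2
    have e := xvar_eq k hr a
    unfold xvar at e
    rw [SetLike.mem_coe, e, ← hf]
    obtain ⟨h2, h3⟩ := h ((a 0 : ℕ) + a 1) (a 2) (by omega)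
    rw [mem_Sphi_iff] at ha
    cases hb : φ (a 2)
    · exact h3 hb (fun h => ha (by simp [hb]; omega))
    · exact h2 hb (fun h => ha (by simp [hb]; omega))

theorem slice_le_tilde (k : Type) [Field k] (t : ℕ) : ISlice k 2 t r ≤ ITilde k 2 t r := by
  apply Ideal.span_mono
  rintro _ ⟨i, a, b, hi, hd, rfl⟩
  exact ⟨i, a, b, hi, rfl⟩

theorem Pphi_le_iff (k : Type) [Field k] (hr : ∀ i, 2 ≤ r i) (φ ψ : Fin (r 2) → Bool)
    (h : Pphi k φ ≤ Pphi k ψ) : φ = ψ := by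
  have h0 := hr 0
  have h1 := hr 1
  funext l
  by_contra hne
  cases hb : φ l <;> cases hc : ψ l <;> rw [hb, hc] at hne <;> simp at hne
  · have h2 : Yv k hr (r 0 - 1 + (r 1 - 1)) l ∉ Pphi k ψ :=
      (Yv_mem_Pphi k hr ψ _ l le_rfl).2 (by simp [hc])
    have h3 := (Yv_mem_Pphi k hr φ _ l le_rfl).1 (fun hx => h2 (h hx))
    have := h3.2 hb
    omega
  · have h2 : Yv k hr 0 l ∉ Pphi k ψ :=
      (Yv_mem_Pphi k hr ψ _ l (by omega)).2 (by simp [hc])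
    have h3 := (Yv_mem_Pphi k hr φ _ l (by omega)).1 (fun hx => h2 (h hx))
    have := h3.1 hb
    omega

theorem not_Pphi_le_tilde (k : Type) [Field k] (t : ℕ) (ht : 1 ≤ t) (hr : ∀ i, 2 ≤ r i)
    (φ : Fin (r 2) → Bool) : ¬ Pphi k φ ≤ ITilde k 2 t r := by
  intro h
  have h0 := hr 0
  have h1 := hr 1
  let l : Fin (r 2) := ⟨0, by have := hr 2; omega⟩
  have h2 : Yv k hr 1 l ∈ Pphi k φ := by
    by_contra hc
    rw [Yv_mem_Pphi k hr φ 1 l (by omega)] at hc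
    cases hb : φ l
    · have := hc.2 hb
      omega
    · have := hc.1 hb
      omega
  have h3 := h h2
  rw [tilde_eq k t ht hr, RingHom.mem_ker, tor_Yv k hr 1 l (by omega)] at h3
  simp at h3

theorem not_tilde_le_Pphi (k : Type) [Field k] (t : ℕ) (ht : 1 ≤ t) (hr : ∀ i, 2 ≤ r i)
    (φ : Fin (r 2) → Bool) (hφ : ∃ l l', φ l ≠ φ l') : ¬ ITilde k 2 t r ≤ Pphi k φ := by
  intro h
  have h0 := hr 0
  have h1 := hr 1
  obtain ⟨l, l', hl, hl'⟩ : ∃ l l', φ l = true ∧ φ l' = false := by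
    obtain ⟨l, l', hne⟩ := hφ
    cases hb : φ l
    · exact ⟨l', l, by simpa [hb] using hne.symm, hb⟩
    · exact ⟨l, l', hb, by simpa [hb] using hne.symm⟩
  have hy := hy_tilde k t ht hr (r 0 - 1 + (r 1 - 1)) 0 0 (r 0 - 1 + (r 1 - 1)) l l' le_rfl
    (by omega) (by omega) le_rfl (by omega)
  simp only at hy
  rw [← map_mul, ← map_mul, Ideal.Quotient.eq] at hy
  have hy := h hy
  have a1 : Yv k hr 0 l ∈ Pphi k φ := by
    by_contra hc
    have := ((Yv_mem_Pphi k hr φ 0 l (by omega)).1 hc).1 hl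
    omega
  have a2 := (Submodule.sub_mem_iff_left _ (Ideal.mul_mem_right _ _ a1)).1 hy
  rcases (Pphi_prime k φ).mem_or_mem a2 with h | h
  · exact (Yv_mem_Pphi k hr φ _ l le_rfl).2 (by simp [hl]) h
  · exact (Yv_mem_Pphi k hr φ _ l' (by omega)).2 (by simp [hl']) h

end Mono

/-- for `n = 3` and `s = 2`, the ideal `I(2,t)` has exactly the following
minimal primes: `Ĩ(2,t)` and, for each non-constant `φ : [r 3] → {(1,1),(r 1,r 2)}`
(encoded by a non-constant `φ : Fin (r 2) → Bool`, `false ↦ (1,1)`, `true ↦ (r 1,r 2)`),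
the monomial prime generated by the variables `x_a` with `a ∉ S^φ`. -/
theorem minimalPrimes_n_three (k : Type) [Field k] (t : ℕ) (r : Fin 3 → ℕ)
    (hr : ∀ i, 2 ≤ r i) (ht1 : 1 ≤ t) (ht3 : t ≤ 3) :
    (ISlice k 2 t r).minimalPrimes =
      insert (ITilde k 2 t r)
        {P | ∃ φ : Fin (r 2) → Bool, (∃ l l', φ l ≠ φ l') ∧
          P = Ideal.span {f | ∃ a : Idx 3 r,
            a ∉ {x : Idx 3 r |
              (φ (x 2) = true → (x 0 : ℕ) = r 0 - 1 ∧ (x 1 : ℕ) = r 1 - 1) ∧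
              (φ (x 2) = false → (x 0 : ℕ) = 0 ∧ (x 1 : ℕ) = 0)} ∧
            f = MvPolynomial.X (Quotient.mk (sSetoid 3 2 r) a)}} := by
  change _ = insert (ITilde k 2 t r)
    {P | ∃ φ : Fin (r 2) → Bool, (∃ l l', φ l ≠ φ l') ∧ P = Pphi k φ}
  have htp : (ITilde k 2 t r).IsPrime := by
    rw [tilde_eq k t ht1 hr]
    exact RingHom.ker_isPrime _
  ext P
  constructor
  · rintro ⟨⟨hp, hle⟩, hmin⟩
    rcases prime_cases k t ht1 hr P hle with h | ⟨φ, hφ, h⟩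
    · left
      exact le_antisymm (hmin ⟨htp, slice_le_tilde k t⟩ h) h
    · right
      exact ⟨φ, hφ, le_antisymm (hmin ⟨Pphi_prime k φ, slice_le_Pphi k t hr φ⟩ h) h⟩
  · rintro (rfl | ⟨φ, hφ, rfl⟩)
    · refine ⟨⟨htp, slice_le_tilde k t⟩, ?_⟩
      rintro Q ⟨hq, hle⟩ hQ
      rcases prime_cases k t ht1 hr Q hle with h | ⟨φ, hφ, h⟩
      · exact h
      · exact absurd (h.trans hQ) (not_Pphi_le_tilde k t ht1 hr φ)
    · refine ⟨⟨Pphi_prime k φ, slice_le_Pphi k t hr φ⟩, ?_⟩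
      rintro Q ⟨hq, hle⟩ hQ
      rcases prime_cases k t ht1 hr Q hle with h | ⟨ψ, hψ, h⟩
      · exact absurd (h.trans hQ) (not_tilde_le_Pphi k t ht1 hr φ hφ)
      · have := Pphi_le_iff k hr ψ φ (h.trans hQ)
        rw [← this]
        exact h
end
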